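/- arXiv:math/0601623 — 2 statements merged into one kernel-verified Lean document; each statement's English description precedes it below -/
import Mathlib

section
/- Every simple graph in which every vertex has degree at most 4 admits a strong edge-coloring using at most 22 colors. -/
/-- Two edges of `G` conflict in a strong edge-coloring: they share an endpoint,
or some endpoint of one is adjacent in `G` to some endpoint of the other. -/
def StrongConflict {V : Type*} (G : SimpleGraph V) (e f : Sym2 V) : Prop :=
  (∃ v, v ∈ e ∧ v ∈ f) ∨ (∃ u v, u ∈ e ∧ v ∈ f ∧ G.Adj u v)

/-- A strong edge-coloring of `G` with `k` colors: conflicting distinct edges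
receive different colors. -/
def IsStrongEdgeColoring {V : Type*} (G : SimpleGraph V) {k : ℕ}
    (C : G.edgeSet → Fin k) : Prop :=
  ∀ e f : G.edgeSet, e ≠ f → StrongConflict G (e : Sym2 V) (f : Sym2 V) → C e ≠ C f

namespace StrongEdgeColoring

open SimpleGraph Finset

variable {V : Type*} {G : SimpleGraph V}

/-- `c` gives different colors to distinct conflicting members of `D`. -/
def ProperOn (G : SimpleGraph V) (D : Set (Sym2 V)) (c : Sym2 V → Fin 22) : Prop :=
  ∀ e ∈ D, ∀ f ∈ D, e ≠ f → StrongConflict G e f → c e ≠ c f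

/-- The edges of `G` lying in the connected component of `r`. -/
def componentEdges (G : SimpleGraph V) (r : V) : Set (Sym2 V) :=
  {e | e ∈ G.edgeSet ∧ ∃ a ∈ e, G.Reachable r a}

/-- The component of `r` has a strong edge-coloring with 22 colors. -/
def ComponentColorable (G : SimpleGraph V) (r : V) : Prop :=
  ∃ c, ProperOn G (componentEdges G r) c

theorem strongConflict_symm {e f : Sym2 V} (h : StrongConflict G e f) :
    StrongConflict G f e := by
  rcases h with ⟨v, hv, hv'⟩ | ⟨u, v, hu, hv, huv⟩
  · exact Or.inl ⟨v, hv', hv⟩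
  · exact Or.inr ⟨v, u, hv, hu, huv.symm⟩

theorem ProperOn.mono {D D' : Set (Sym2 V)} {c : Sym2 V → Fin 22} (h : ProperOn G D c)
    (hD : D' ⊆ D) : ProperOn G D' c :=
  fun e he f hf => h e (hD he) f (hD hf)

theorem ComponentColorable.of_reachable {r v : V} (h : ComponentColorable G r)
    (hr : G.Reachable v r) : ComponentColorable G v := by
  obtain ⟨c, hc⟩ := h
  refine ⟨c, hc.mono ?_⟩
  rintro e ⟨he, a, ha, hva⟩
  exact ⟨he, a, ha, hr.symm.trans hva⟩

theorem exists_coloring_of_components (h : ∀ v, ComponentColorable G v) :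
    ∃ C : G.edgeSet → Fin 22, IsStrongEdgeColoring G C := by
  choose c hc using h
  have hout : ∀ a, G.Reachable (G.connectedComponentMk a).out a := fun a =>
    ConnectedComponent.exact (Quot.out_eq (G.connectedComponentMk a))
  have hmem : ∀ e : Sym2 V, e.out.1 ∈ e := fun e => e.out_fst_mem
  have hwithin : ∀ e ∈ G.edgeSet, ∀ a ∈ e, ∀ b ∈ e, G.Reachable a b := by
    intro e
    induction e using Sym2.ind with
    | _ x y =>
      intro he a ha b hb
      have hxy : G.Reachable x y := Adj.reachable he
      rcases Sym2.mem_iff.1 ha with rfl | rfl <;> rcases Sym2.mem_iff.1 hb with rfl | rfl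
      exacts [Reachable.refl _, hxy, hxy.symm, Reachable.refl _]
  refine ⟨fun e => c (G.connectedComponentMk (e : Sym2 V).out.1).out e, ?_⟩
  rintro ⟨e, he⟩ ⟨f, hf⟩ hne hconf
  have hreach : G.Reachable e.out.1 f.out.1 := by
    rcases hconf with ⟨v, hv, hv'⟩ | ⟨u, v, hu, hv, huv⟩
    · exact (hwithin e he _ (hmem e) v hv).trans (hwithin f hf v hv' _ (hmem f))
    · exact ((hwithin e he _ (hmem e) u hu).trans huv.reachable).trans
        (hwithin f hf v hv _ (hmem f))
  have heq : G.connectedComponentMk e.out.1 = G.connectedComponentMk f.out.1 :=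
    ConnectedComponent.sound hreach
  simp only [heq]
  refine hc _ e ⟨he, _, hmem e, ?_⟩ f ⟨hf, _, hmem f, hout _⟩ (by simpa using hne) hconf
  rw [← heq]
  exact hout _

/-- An edge in conflict with `ab` is incident with a further neighbor of `a` or of `b`. -/
theorem exists_mem_of_strongConflict {a b : V} (hab : G.Adj a b) {f : Sym2 V}
    (hf : f ∈ G.edgeSet) (hne : f ≠ s(a, b)) (h : StrongConflict G s(a, b) f) :
    (∃ u ∈ f, G.Adj a u ∧ u ≠ b) ∨ ∃ u ∈ f, G.Adj b u ∧ u ≠ a := by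
  induction f using Sym2.ind with
  | _ x y =>
    have hxy : G.Adj x y := hf
    have hyx := hxy.symm
    have hba := hab.symm
    simp only [StrongConflict, Sym2.mem_iff, ne_eq, Sym2.eq_iff] at *
    have := hab.ne
    have := hxy.ne
    grind

/-- The four vertices are pairwise distinct and are exactly the neighbors of `r`. -/
def IsNeighborhood (G : SimpleGraph V) (r w₁ w₂ w₃ w₄ : V) : Prop :=
  [w₁, w₂, w₃, w₄].Nodup ∧ ∀ w, w ∈ [w₁, w₂, w₃, w₄] ↔ G.Adj r w

theorem IsNeighborhood.perm {r w₁ w₂ w₃ w₄ x₁ x₂ x₃ x₄ : V}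
    (h : IsNeighborhood G r w₁ w₂ w₃ w₄) (hp : [x₁, x₂, x₃, x₄].Perm [w₁, w₂, w₃, w₄]) :
    IsNeighborhood G r x₁ x₂ x₃ x₄ :=
  ⟨hp.nodup_iff.2 h.1, fun w => hp.mem_iff.trans (h.2 w)⟩

theorem IsNeighborhood.nodup_append {r w₁ w₂ w₃ w₄ z₁ z₂ z₃ z₄ : V}
    (hN : IsNeighborhood G r w₁ w₂ w₃ w₄)
    (htri : ∀ a b, G.Adj r a → G.Adj r b → ¬ G.Adj a b) (h₁ : G.Adj w₁ z₁) (h₂ : G.Adj w₂ z₂)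
    (h₃ : G.Adj w₃ z₃) (h₄ : G.Adj w₄ z₄) (hz : [z₁, z₂, z₃, z₄].Nodup) :
    [w₁, w₂, w₃, w₄, z₁, z₂, z₃, z₄].Nodup := by
  refine (List.nodup_append (l₁ := [w₁, w₂, w₃, w₄])).2 ⟨hN.1, hz, ?_⟩
  rintro a ha b hb rfl
  have hra := (hN.2 a).1 ha
  have hmem : ∀ w, w ∈ [w₁, w₂, w₃, w₄] → G.Adj r w := fun w => (hN.2 w).1
  simp only [List.mem_cons, List.not_mem_nil, or_false] at hb
  rcases hb with rfl | rfl | rfl | rfl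
  exacts [htri _ _ (hmem w₁ (by simp)) hra h₁, htri _ _ (hmem w₂ (by simp)) hra h₂,
    htri _ _ (hmem w₃ (by simp)) hra h₃, htri _ _ (hmem w₄ (by simp)) hra h₄]

theorem not_strongConflict {w x y z : V} (hwx : w ≠ x) (hyz : y ≠ z) (hwz : w ≠ z) (hxy : x ≠ y)
    (hwx' : ¬ G.Adj w x) (hyz' : ¬ G.Adj y z) (hwz' : ¬ G.Adj w z) (hxy' : ¬ G.Adj x y) :
    ¬ StrongConflict G s(w, y) s(x, z) := by
  have := fun h : G.Adj y x => hxy' h.symm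
  simp only [StrongConflict, Sym2.mem_iff]
  grind

/-- The edges `wy` and `xz`, where `w` and `x` are neighbors of `r`, do not conflict. -/
def IsFreePair (G : SimpleGraph V) (r w x y z : V) : Prop :=
  (G.Adj w y ∧ G.Adj x z ∧ y ≠ r ∧ z ≠ r) ∧ y ≠ z ∧ ¬ G.Adj y z ∧ ¬ G.Adj w z ∧ ¬ G.Adj x y

theorem IsFreePair.not_strongConflict {r w x y z : V} (h : IsFreePair G r w x y z)
    (hw : G.Adj r w) (hx : G.Adj r x) (hwx : w ≠ x)
    (htri : ∀ a b, G.Adj r a → G.Adj r b → ¬ G.Adj a b) :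
    ¬ StrongConflict G s(w, y) s(x, z) := by
  obtain ⟨⟨hwy, hxz, -, -⟩, hyz, hyz', hwz, hxy⟩ := h
  refine StrongEdgeColoring.not_strongConflict hwx hyz ?_ ?_ (htri w x hw hx) hyz' hwz hxy
  · rintro rfl; exact htri _ _ hx hw hxz
  · rintro rfl; exact htri _ _ hw hx hwy

/-- A triangle-free graph on three classes of size two joined by matchings has an independent
transversal. -/
theorem exists_independent_transversal {p p' q q' t t' : V}
    (hp : ∀ x ∈ [p, p'], ¬ (G.Adj x q ∧ G.Adj x q') ∧ ¬ (G.Adj x t ∧ G.Adj x t'))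
    (hq : ∀ x ∈ [q, q'], ¬ (G.Adj x p ∧ G.Adj x p') ∧ ¬ (G.Adj x t ∧ G.Adj x t'))
    (ht : ∀ x ∈ [t, t'], ¬ (G.Adj x p ∧ G.Adj x p') ∧ ¬ (G.Adj x q ∧ G.Adj x q'))
    (htri : ∀ x ∈ [p, p'], ∀ y z, G.Adj x y → G.Adj x z → ¬ G.Adj y z) :
    ∃ x ∈ [p, p'], ∃ y ∈ [q, q'], ∃ z ∈ [t, t'], ¬ G.Adj x y ∧ ¬ G.Adj x z ∧ ¬ G.Adj y z := by
  by_contra! h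
  have htri' : ∀ x ∈ [p, p'], ∀ y ∈ [q, q'], ∀ z ∈ [t, t'],
      ¬ (G.Adj x y ∧ G.Adj x z ∧ G.Adj y z) :=
    fun x hx y _ z _ hxyz => htri x hx y z hxyz.1 hxyz.2.1 hxyz.2.2
  simp only [List.mem_cons, List.not_mem_nil, or_false, forall_eq_or_imp, forall_eq,
    G.adj_comm q p, G.adj_comm q p', G.adj_comm q' p, G.adj_comm q' p', G.adj_comm t p,
    G.adj_comm t p', G.adj_comm t' p, G.adj_comm t' p', G.adj_comm t q,
    G.adj_comm t q', G.adj_comm t' q, G.adj_comm t' q'] at hp hq ht h htri'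
  by_cases h1 : G.Adj p q <;> by_cases h2 : G.Adj p t <;> by_cases h3 : G.Adj q t <;>
    simp_all

variable [DecidableEq V]

theorem ProperOn.extend_one {D : Set (Sym2 V)} {c : Sym2 V → Fin 22} (h : ProperOn G D c)
    {e : Sym2 V} {Y : Finset (Sym2 V)}
    (hY : ∀ f ∈ D, f ≠ e → StrongConflict G e f → f ∈ Y) (hc : (Y.image c).card ≤ 21) :
    ∃ c', ProperOn G (insert e D) c' ∧ (∀ f, f ≠ e → c' f = c f) ∧ ∀ f ∈ D, c' f = c f := by
  by_cases he : e ∈ D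
  · exact ⟨c, by rwa [Set.insert_eq_of_mem he], fun _ _ => rfl, fun _ _ => rfl⟩
  obtain ⟨x, hx⟩ : ∃ x, x ∉ Y.image c := by
    by_contra! hall
    have : Y.image c = univ := eq_univ_iff_forall.2 hall
    simp [this] at hc
  have hx' : ∀ f ∈ D, f ≠ e → StrongConflict G e f → x ≠ c f := fun f hf hne hcf hxf =>
    hx (hxf ▸ mem_image_of_mem c (hY f hf hne hcf))
  refine ⟨Function.update c e x, ?_, fun f hf => Function.update_of_ne hf _ _, fun f hf =>
    Function.update_of_ne (by rintro rfl; exact he hf) _ _⟩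
  rintro a (rfl | ha) b (rfl | hb) hab hconf
  · exact absurd rfl hab
  · rw [Function.update_self, Function.update_of_ne hab.symm]
    exact hx' b hb hab.symm hconf
  · rw [Function.update_self, Function.update_of_ne hab]
    exact (hx' a ha hab (strongConflict_symm hconf)).symm
  · rw [Function.update_of_ne (by rintro rfl; exact he ha),
      Function.update_of_ne (by rintro rfl; exact he hb)]
    exact h a ha b hb hab hconf

theorem ProperOn.extend_list (r : V) (l : List V) :
    ∀ (D : Set (Sym2 V)) (c : Sym2 V → Fin 22) (Y : V → Finset (Sym2 V)), ProperOn G D c →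
      (∀ w ∈ l, ∀ f ∈ D, f ≠ s(r, w) → StrongConflict G s(r, w) f → f ∈ Y w) →
      (∀ i (hi : i < l.length), ((Y l[i]).image c).card + i ≤ 21) →
      ∃ c', ProperOn G (D ∪ {e | ∃ w ∈ l, e = s(r, w)}) c' := by
  induction l with
  | nil => exact fun D c Y h _ _ => ⟨c, by simpa using h⟩
  | cons w l ih =>
    intro D c Y h hY hcard
    obtain ⟨c₁, h₁, hne, -⟩ := h.extend_one (hY w (by simp)) (by
      have := hcard 0 (by simp)
      simp only [List.getElem_cons_zero] at this
      omega)
    obtain ⟨c₂, h₂⟩ := ih (insert s(r, w) D) c₁ (fun x => insert s(r, w) (Y x)) h₁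
      (by
        rintro x hx f (rfl | hf) hfx hconf
        · exact mem_insert_self _ _
        · exact mem_insert_of_mem (hY x (by simp [hx]) f hf hfx hconf))
      (by
        intro i hi
        have hsub : (insert s(r, w) (Y l[i])).image c₁ ⊆
            insert (c₁ s(r, w)) ((Y l[i]).image c) := by
          intro y hy
          obtain ⟨f, hf, rfl⟩ := mem_image.1 hy
          by_cases hfe : f = s(r, w)
          · simp [hfe]
          · rw [hne f hfe]
            exact mem_insert_of_mem (mem_image_of_mem c ((mem_insert.1 hf).resolve_left hfe))
        have h1 := card_le_card hsub
        have h2 := card_insert_le (c₁ s(r, w)) ((Y l[i]).image c)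
        have h3 := hcard (i + 1) (by simpa using hi)
        simp only [List.getElem_cons_succ] at h3
        omega)
    refine ⟨c₂, h₂.mono ?_⟩
    rintro e (he | ⟨x, hx, rfl⟩)
    · exact Or.inl (Or.inr he)
    · rcases List.mem_cons.1 hx with rfl | hx
      · exact Or.inl (Or.inl rfl)
      · exact Or.inr ⟨x, hx, rfl⟩

/-- Four vertex-disjoint edges at the neighbors of `r`. -/
theorem matching_of_distinct {w₁ w₂ w₃ w₄ z₁ z₂ z₃ z₄ : V}
    (h : [w₁, w₂, w₃, w₄, z₁, z₂, z₃, z₄].Nodup) :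
    ∀ x, ∀ e ∈ ({s(w₁, z₁), s(w₂, z₂), s(w₃, z₃), s(w₄, z₄)} : Finset (Sym2 V)),
      ∀ f ∈ ({s(w₁, z₁), s(w₂, z₂), s(w₃, z₃), s(w₄, z₄)} : Finset (Sym2 V)),
        x ∈ e → x ∈ f → e = f := by
  simp only [List.nodup_cons, List.mem_cons, List.not_mem_nil, or_false, not_or] at h
  intro x e he f hf hxe hxf
  simp only [mem_insert, mem_singleton] at he hf
  rcases he with rfl | rfl | rfl | rfl <;> rcases hf with rfl | rfl | rfl | rfl <;>
    first
      | rfl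
      | (exfalso
         rcases Sym2.mem_iff.1 hxe with rfl | rfl <;> rcases Sym2.mem_iff.1 hxf with h' | h' <;>
           simp_all)

variable [Fintype V] [DecidableRel G.Adj]

/-- The edges incident with `u`. -/
def star (G : SimpleGraph V) [DecidableRel G.Adj] (u : V) : Finset (Sym2 V) :=
  (G.neighborFinset u).image (fun z => s(u, z))

/-- The edges incident with `w`, other than the one joining it to `r`. -/
def branch (G : SimpleGraph V) [DecidableRel G.Adj] (r w : V) : Finset (Sym2 V) :=
  ((G.neighborFinset w).erase r).image (fun z => s(w, z))

theorem mem_star_of_mem {u : V} {e : Sym2 V} (he : e ∈ G.edgeSet) (hu : u ∈ e) :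
    e ∈ star G u := by
  obtain ⟨z, rfl⟩ := hu
  exact mem_image_of_mem _ (by simpa using he)

theorem card_star_le (hdeg : ∀ v, G.degree v ≤ 4) (u : V) : (star G u).card ≤ 4 :=
  card_image_le.trans (by simpa using hdeg u)

theorem card_neighborFinset_erase_le (hdeg : ∀ v, G.degree v ≤ 4) {u v : V} (h : G.Adj u v) :
    ((G.neighborFinset u).erase v).card ≤ 3 := by
  rw [card_erase_of_mem (by simpa using h)]
  have := hdeg u
  rw [← card_neighborFinset_eq_degree] at this
  omega

theorem card_branch_le (hdeg : ∀ v, G.degree v ≤ 4) {r w : V} (h : G.Adj r w) :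
    (branch G r w).card ≤ 3 :=
  card_image_le.trans (card_neighborFinset_erase_le hdeg h.symm)

theorem ProperOn.extend_away (hdeg : ∀ v, G.degree v ≤ 4) (r : V) {M : Finset (Sym2 V)}
    {c₀ : Sym2 V → Fin 22} (hM : ∀ x, ∀ e ∈ M, ∀ f ∈ M, x ∈ e → x ∈ f → e = f)
    (hME : ∀ e ∈ M, e ∈ G.edgeSet) (hc₀ : ProperOn G M c₀) :
    ∃ c, (∀ e ∈ M, c e = c₀ e) ∧
      ProperOn G (M ∪ {e | e ∈ componentEdges G r ∧ r ∉ e}) c := by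
  classical
  let ρ : Sym2 V → ℕ := fun e => (e.map (G.dist r)).inf
  have key : ∀ T : Finset (Sym2 V), (∀ e ∈ T, e ∈ componentEdges G r ∧ r ∉ e) →
      ∃ c, (∀ e ∈ M, c e = c₀ e) ∧ ProperOn G (M ∪ T) c := by
    intro T
    induction T using Finset.induction_on_min_value ρ with
    | empty => exact fun _ => ⟨c₀, fun _ _ => rfl, by simpa using hc₀⟩
    | insert e T heT hmin ih =>
      intro hT
      obtain ⟨c, hcM, hc⟩ := ih fun f hf => hT f (mem_insert_of_mem hf)
      obtain ⟨⟨heG, x, hx, hrx⟩, hre⟩ := hT e (mem_insert_self _ _)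
      obtain ⟨a, b, rfl, hle⟩ : ∃ a b, e = s(a, b) ∧ G.dist r a ≤ G.dist r b := by
        induction e using Sym2.ind with
        | _ a b =>
          rcases le_total (G.dist r a) (G.dist r b) with h | h
          · exact ⟨a, b, rfl, h⟩
          · exact ⟨b, a, Sym2.eq_swap, h⟩
      have hab : G.Adj a b := heG
      have hra : G.Reachable r a := by
        rcases Sym2.mem_iff.1 hx with rfl | rfl
        · exact hrx
        · exact hrx.trans hab.symm.reachable
      have hane : r ≠ a := by rintro rfl; exact hre (Sym2.mem_mk_left _ _)
      obtain ⟨w, haw, hdist⟩ : ∃ w, G.Adj a w ∧ G.dist r w < G.dist r a := by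
        obtain ⟨p, hp⟩ := hra.symm.exists_walk_length_eq_dist
        cases p with
        | nil => exact absurd rfl hane
        | @cons _ w _ h q =>
          refine ⟨w, h, ?_⟩
          rw [dist_comm, dist_comm (u := r) (v := a), ← hp, Walk.length_cons]
          exact Nat.lt_succ_of_le (dist_le q)
      have hwb : w ≠ b := by rintro rfl; omega
      have hlow : ∀ f ∈ T, w ∉ f := by
        intro f hf hwf
        obtain ⟨z, rfl⟩ := hwf
        have := hmin _ hf
        simp only [ρ, Sym2.map_mk, Sym2.inf_mk] at this
        simp at this
        omega
      let Y := (((G.neighborFinset a).erase b).erase w).biUnion (star G) ∪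
        ((G.neighborFinset b).erase a).biUnion (star G) ∪ M.filter (w ∈ ·)
      have hYcard : Y.card ≤ 21 := by
        have h1 : (((G.neighborFinset a).erase b).erase w).card ≤ 2 := by
          rw [card_erase_of_mem (by simp [haw, hwb])]
          have := card_neighborFinset_erase_le hdeg hab
          omega
        have h2 := card_neighborFinset_erase_le hdeg hab.symm
        have h3 : (M.filter (w ∈ ·)).card ≤ 1 := by
          refine card_le_one.2 fun e he f hf => ?_
          rw [mem_filter] at he hf
          exact hM w e he.1 f hf.1 he.2 hf.2
        have h4 := card_biUnion_le_card_mul _ (star G) 4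
          fun u (_ : u ∈ ((G.neighborFinset a).erase b).erase w) => card_star_le hdeg u
        have h5 := card_biUnion_le_card_mul _ (star G) 4
          fun u (_ : u ∈ (G.neighborFinset b).erase a) => card_star_le hdeg u
        have h6 := card_union_le ((((G.neighborFinset a).erase b).erase w).biUnion (star G) ∪
          ((G.neighborFinset b).erase a).biUnion (star G)) (M.filter (w ∈ ·))
        have h7 := card_union_le ((((G.neighborFinset a).erase b).erase w).biUnion (star G))
          (((G.neighborFinset b).erase a).biUnion (star G))
        simp only [Y]
        omega
      obtain ⟨c', hc', -, hagree⟩ := hc.extend_one (e := s(a, b)) (Y := Y)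
        (by
          intro f hf hne hconf
          have hfG : f ∈ G.edgeSet := by
            rcases hf with hf | hf
            · exact hME f hf
            · exact (hT f (mem_insert_of_mem hf)).1.1
          simp only [Y, mem_union, mem_biUnion, mem_erase, mem_neighborFinset, mem_filter]
          by_cases hwf : w ∈ f
          · refine Or.inr ⟨?_, hwf⟩
            rcases hf with hf | hf
            · exact hf
            · exact absurd hwf (hlow f hf)
          · refine Or.inl ?_
            rcases exists_mem_of_strongConflict hab hfG hne hconf with
              ⟨u, huf, hau, hub⟩ | ⟨u, huf, hbu, hua⟩
            · refine Or.inl ⟨u, ⟨?_, hub, hau⟩, mem_star_of_mem hfG huf⟩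
              rintro rfl
              exact hwf huf
            · exact Or.inr ⟨u, ⟨hua, hbu⟩, mem_star_of_mem hfG huf⟩)
        (card_image_le.trans hYcard)
      refine ⟨c', fun f hf => (hagree f (Or.inl hf)).trans (hcM f hf), hc'.mono ?_⟩
      rintro f (hf | hf)
      · exact Or.inr (Or.inl hf)
      · rcases mem_insert.1 hf with rfl | hf
        · exact Or.inl rfl
        · exact Or.inr (Or.inr hf)
  obtain ⟨c, hcM, hc⟩ := key (univ.filter fun e => e ∈ componentEdges G r ∧ r ∉ e) (by simp)
  exact ⟨c, hcM, hc.mono (by simp)⟩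

/-- The colored edges that may conflict with the edge joining `r` to its neighbor `w`. -/
def around (G : SimpleGraph V) [DecidableRel G.Adj] (r w : V) : Finset (Sym2 V) :=
  ((G.neighborFinset r).erase w).biUnion (branch G r) ∪
    ((G.neighborFinset w).erase r).biUnion (star G)

theorem mem_around {r w : V} (hrw : G.Adj r w) {f : Sym2 V} (hf : f ∈ G.edgeSet) (hr : r ∉ f)
    (h : StrongConflict G s(r, w) f) : f ∈ around G r w := by
  have hne : f ≠ s(r, w) := by rintro rfl; exact hr (Sym2.mem_mk_left _ _)
  simp only [around, mem_union, mem_biUnion, mem_erase, mem_neighborFinset]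
  rcases exists_mem_of_strongConflict hrw hf hne h with ⟨u, huf, hru, huw⟩ | ⟨u, huf, hwu, hur⟩
  · refine Or.inl ⟨u, ⟨huw, hru⟩, ?_⟩
    obtain ⟨z, rfl⟩ := huf
    refine mem_image_of_mem _ (mem_erase.2 ⟨?_, by simpa using hf⟩)
    rintro rfl
    exact hr (Sym2.mem_mk_right _ _)
  · exact Or.inr ⟨u, ⟨hur, hwu⟩, mem_star_of_mem hf huf⟩

theorem componentColorable_of_list (hdeg : ∀ v, G.degree v ≤ 4) (r : V) {M : Finset (Sym2 V)}
    {c₀ : Sym2 V → Fin 22} (hM : ∀ x, ∀ e ∈ M, ∀ f ∈ M, x ∈ e → x ∈ f → e = f)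
    (hME : ∀ e ∈ M, e ∈ G.edgeSet) (hMr : ∀ e ∈ M, r ∉ e) (hc₀ : ProperOn G M c₀)
    (l : List V) (hl : ∀ w, w ∈ l ↔ G.Adj r w)
    (h : ∀ c : Sym2 V → Fin 22, (∀ e ∈ M, c e = c₀ e) → ∀ i (hi : i < l.length),
      (((around G r l[i]).filter (r ∉ ·)).image c).card + i ≤ 21) :
    ComponentColorable G r := by
  obtain ⟨c, hcM, hc⟩ := ProperOn.extend_away hdeg r hM hME hc₀
  obtain ⟨c', hc'⟩ := hc.extend_list r l _ _ (fun w => (around G r w).filter (r ∉ ·))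
    (by
      intro w hw f hf _ hconf
      have hfr : f ∈ G.edgeSet ∧ r ∉ f := by
        rcases hf with hf | hf
        · exact ⟨hME f hf, hMr f hf⟩
        · exact ⟨hf.1.1, hf.2⟩
      exact mem_filter.2 ⟨mem_around ((hl w).1 hw) hfr.1 hfr.2 hconf, hfr.2⟩)
    (h c hcM)
  refine ⟨c', hc'.mono fun e he => ?_⟩
  by_cases hre : r ∈ e
  · obtain ⟨w, rfl⟩ := hre
    exact Or.inr ⟨w, (hl w).2 he.1, rfl⟩
  · exact Or.inl (Or.inr ⟨he, hre⟩)

theorem card_biUnion_branch_le (hdeg : ∀ v, G.degree v ≤ 4) {r : V} {S : Finset V}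
    (hS : ∀ w ∈ S, G.Adj r w) : (S.biUnion (branch G r)).card ≤ S.card * 3 :=
  card_biUnion_le_card_mul _ _ _ fun w hw => card_branch_le hdeg (hS w hw)

theorem card_biUnion_star_le (hdeg : ∀ v, G.degree v ≤ 4) (S : Finset V) :
    (S.biUnion (star G)).card ≤ S.card * 4 :=
  card_biUnion_le_card_mul _ _ _ fun w _ => card_star_le hdeg w

theorem componentColorable_of_degree_le_three (hdeg : ∀ v, G.degree v ≤ 4) {r : V}
    (hr : G.degree r ≤ 3) : ComponentColorable G r := by
  refine componentColorable_of_list hdeg r (M := ∅) (c₀ := fun _ => 0) (by simp) (by simp)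
    (by simp) (by simp [ProperOn]) (G.neighborFinset r).toList (by simp) fun c _ i hi => ?_
  set w := (G.neighborFinset r).toList[i] with hw
  have hrw : G.Adj r w := by
    have : w ∈ (G.neighborFinset r).toList := List.getElem_mem hi
    simpa using this
  have h1 : ((G.neighborFinset r).erase w).card ≤ 2 := by
    rw [card_erase_of_mem (by simpa using hrw), card_neighborFinset_eq_degree]
    omega
  have h2 := card_neighborFinset_erase_le hdeg hrw.symm
  have h3 := card_biUnion_branch_le hdeg (S := (G.neighborFinset r).erase w)
    (r := r) (fun x hx => by simpa using (mem_erase.1 hx).2)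
  have h4 := card_biUnion_star_le hdeg ((G.neighborFinset w).erase r)
  have h5 : (((around G r w).filter (r ∉ ·)).image c).card ≤ (around G r w).card :=
    card_image_le.trans (card_filter_le _ _)
  have h6 : (around G r w).card ≤ _ := card_union_le _ _
  have h7 : i < G.degree r := by simpa using hi
  omega

theorem exists_isNeighborhood {r a b : V} (hr : G.degree r = 4) (ha : G.Adj r a)
    (hb : G.Adj r b) (hab : a ≠ b) : ∃ c d, IsNeighborhood G r c d b a := by
  have h2 : (((G.neighborFinset r).erase a).erase b).card = 2 := by
    rw [card_erase_of_mem (by simp [hb, hab.symm]), card_erase_of_mem (by simpa using ha),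
      card_neighborFinset_eq_degree, hr]
  obtain ⟨c, d, hcd, heq⟩ := card_eq_two.1 h2
  have hmem : ∀ x, (x ≠ b ∧ x ≠ a ∧ G.Adj r x) ↔ (x = c ∨ x = d) := fun x => by
    have := congrArg (x ∈ ·) heq
    simpa using this
  refine ⟨c, d, ?_, fun w => ?_⟩
  · have h₁ := (hmem c).2 (Or.inl rfl)
    have h₂ := (hmem d).2 (Or.inr rfl)
    simp [hcd, h₁.1, h₁.2.1, h₂.1, h₂.2.1, hab.symm]
  · have := hmem w
    simp only [List.mem_cons, List.not_mem_nil, or_false]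
    constructor
    · rintro (rfl | rfl | rfl | rfl)
      exacts [((hmem _).2 (Or.inl rfl)).2.2, ((hmem _).2 (Or.inr rfl)).2.2, hb, ha]
    · intro hw
      by_cases hwb : w = b
      · simp [hwb]
      by_cases hwa : w = a
      · simp [hwa]
      rcases this.1 ⟨hwb, hwa, hw⟩ with h | h <;> simp [h]

theorem componentColorable_of_triangle (hdeg : ∀ v, G.degree v ≤ 4) {r a b : V}
    (hr : G.degree r = 4) (ha : G.Adj r a) (hb : G.Adj r b) (hab : G.Adj a b) :
    ComponentColorable G r := by
  obtain ⟨p, q, hpq⟩ := exists_isNeighborhood hr ha hb hab.ne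
  have hnear : ∀ x y, G.Adj r x → G.Adj r y → G.Adj x y →
      ((around G r x).filter (r ∉ ·)).card ≤ 17 := by
    intro x y hx hy hxy
    have hsub : (around G r x).filter (r ∉ ·) ⊆
        ((G.neighborFinset r).erase x).biUnion (branch G r) ∪
          (((G.neighborFinset x).erase r).erase y).biUnion (star G) := by
      intro f hf
      simp only [around, mem_filter, mem_union, mem_biUnion] at hf ⊢
      obtain ⟨h | ⟨u, hu, hfu⟩, hrf⟩ := hf
      · exact Or.inl h
      · by_cases huy : u = y
        · subst huy
          refine Or.inl ⟨u, by simp [hy, hxy.ne'], ?_⟩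
          obtain ⟨z, hz, rfl⟩ := mem_image.1 hfu
          refine mem_image_of_mem _ (mem_erase.2 ⟨?_, hz⟩)
          rintro rfl
          exact hrf (Sym2.mem_mk_right _ _)
        · exact Or.inr ⟨u, mem_erase.2 ⟨huy, hu⟩, hfu⟩
    have h1 := card_neighborFinset_erase_le hdeg hx
    have h2 : (((G.neighborFinset x).erase r).erase y).card ≤ 2 := by
      rw [card_erase_of_mem (by simp [hxy, hy.ne'])]
      have := card_neighborFinset_erase_le hdeg hx.symm
      omega
    have h3 := card_biUnion_branch_le hdeg (S := (G.neighborFinset r).erase x)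
      (r := r) (fun x hx => by simpa using (mem_erase.1 hx).2)
    have h4 := card_biUnion_star_le hdeg (((G.neighborFinset x).erase r).erase y)
    have h5 := (card_le_card hsub).trans (card_union_le _ _)
    omega
  have hfar : ∀ x, G.Adj r x → x ≠ a → x ≠ b →
      ((around G r x).filter (r ∉ ·)).card ≤ 20 := by
    intro x hx hxa hxb
    have hmem : s(a, b) ∈ branch G r a ∩ branch G r b := by
      refine mem_inter.2 ⟨mem_image_of_mem _ (by simp [hab, hb.ne']), ?_⟩
      rw [Sym2.eq_swap]
      exact mem_image_of_mem _ (by simp [hab.symm, ha.ne'])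
    have h1 : (branch G r a ∪ branch G r b).card ≤ 5 := by
      have := card_union_add_card_inter (branch G r a) (branch G r b)
      have := card_pos.2 ⟨_, hmem⟩
      have := card_branch_le hdeg ha
      have := card_branch_le hdeg hb
      omega
    have hsub : ((G.neighborFinset r).erase x).biUnion (branch G r) ⊆
        (branch G r a ∪ branch G r b) ∪
          ((((G.neighborFinset r).erase x).erase a).erase b).biUnion (branch G r) := by
      intro f hf
      obtain ⟨u, hu, hfu⟩ := mem_biUnion.1 hf
      by_cases hua : u = a
      · subst hua; simp [hfu]
      by_cases hub : u = b
      · subst hub; simp [hfu]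
      exact mem_union_right _ (mem_biUnion.2 ⟨u, by simp_all, hfu⟩)
    have h2 := (card_le_card hsub).trans (card_union_le _ _)
    have h3 : ((((G.neighborFinset r).erase x).erase a).erase b).card ≤ 1 := by
      rw [card_erase_of_mem (by simp [hb, hxb.symm, hab.ne']),
        card_erase_of_mem (by simp [ha, hxa.symm])]
      have := card_neighborFinset_erase_le hdeg hx
      omega
    have h4 := card_biUnion_branch_le hdeg
      (S := (((G.neighborFinset r).erase x).erase a).erase b)
      (r := r) (fun x hx => by simp_all)
    have h5 := card_biUnion_star_le hdeg ((G.neighborFinset x).erase r)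
    have h6 := card_neighborFinset_erase_le hdeg hx.symm
    have h7 : (around G r x).card ≤ _ := card_union_le _ _
    have h8 := card_filter_le (around G r x) (r ∉ ·)
    omega
  obtain ⟨hnd, hmem⟩ := hpq
  have hp : G.Adj r p := (hmem p).1 (by simp)
  have hq : G.Adj r q := (hmem q).1 (by simp)
  simp at hnd
  refine componentColorable_of_list hdeg r (M := ∅) (c₀ := fun _ => 0) (by simp) (by simp)
    (by simp) (by simp [ProperOn]) [p, q, b, a] hmem fun c _ i hi => ?_
  refine le_trans (Nat.add_le_add_right card_image_le _) ?_
  simp only [List.length_cons, List.length_nil] at hi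
  interval_cases i
  · have := hfar p hp (by tauto) (by tauto)
    simp only [List.getElem_cons_zero]
    omega
  · have := hfar q hq (by tauto) (by tauto)
    simp only [List.getElem_cons_zero, List.getElem_cons_succ]
    omega
  · have := hnear b a hb ha hab.symm
    simp only [List.getElem_cons_zero, List.getElem_cons_succ]
    omega
  · have := hnear a b ha hb hab
    simp only [List.getElem_cons_zero, List.getElem_cons_succ]
    omega

/-- Paths from `w` to a further neighbor of `r`, of length two and avoiding `r`: the 4-cycles
through `r` and `w`. -/
def shared (G : SimpleGraph V) [DecidableRel G.Adj] (r w : V) : Finset (V × V) :=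
  (((G.neighborFinset w).erase r) ×ˢ ((G.neighborFinset r).erase w)).filter
    fun p => G.Adj p.1 p.2

theorem mem_shared {r w u x : V} :
    (u, x) ∈ shared G r w ↔ u ≠ r ∧ x ≠ w ∧ G.Adj w u ∧ G.Adj r x ∧ G.Adj u x := by
  simp only [shared, mem_filter, mem_product, mem_erase, mem_neighborFinset]
  tauto

theorem card_around_add_card_shared_le (hdeg : ∀ v, G.degree v ≤ 4) {r w : V} (hw : G.Adj r w)
    (htri : ∀ a b, G.Adj r a → G.Adj r b → ¬ G.Adj a b) :
    (around G r w).card + (shared G r w).card ≤ 21 := by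
  have h1 := card_neighborFinset_erase_le hdeg hw
  have h2 := card_neighborFinset_erase_le hdeg hw.symm
  have h3 := card_biUnion_branch_le hdeg (S := (G.neighborFinset r).erase w)
    (r := r) (fun x hx => by simpa using (mem_erase.1 hx).2)
  have h4 := card_biUnion_star_le hdeg ((G.neighborFinset w).erase r)
  have h5 := card_union_add_card_inter (((G.neighborFinset r).erase w).biUnion (branch G r))
    (((G.neighborFinset w).erase r).biUnion (star G))
  have h6 : (shared G r w).card ≤ (((G.neighborFinset r).erase w).biUnion (branch G r) ∩
      ((G.neighborFinset w).erase r).biUnion (star G)).card := by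
    refine card_le_card_of_injOn (fun p => s(p.1, p.2)) ?_ ?_
    · rintro ⟨u, x⟩ hp
      obtain ⟨hur, hxw, hwu, hrx, hux⟩ := mem_shared.1 hp
      refine mem_inter.2 ⟨mem_biUnion.2 ⟨x, by simp [hxw, hrx], ?_⟩,
        mem_biUnion.2 ⟨u, by simp [hur, hwu], mem_image_of_mem _ (by simpa using hux)⟩⟩
      dsimp only
      rw [Sym2.eq_swap]
      exact mem_image_of_mem _ (by simp [hur, hux.symm])
    · rintro ⟨u, x⟩ hp ⟨u', x'⟩ hp' heq
      obtain ⟨-, -, hwu, hrx, -⟩ := mem_shared.1 hp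
      obtain ⟨-, -, -, hrx', -⟩ := mem_shared.1 hp'
      rcases Sym2.eq_iff.1 heq with ⟨h, h'⟩ | ⟨h, -⟩
      · exact Prod.ext h h'
      · dsimp only at h
        subst h
        exact absurd hwu (htri _ _ hw hrx')
  simp only [around]
  omega

/-- If the edges of `M` are precolored so that those of `R ⊆ M` repeat colors from `M \ R`, every
edge at `r` sees at least `#R` fewer colors than colored edges. Further savings come from the
4-cycles through that edge. -/
theorem componentColorable_of_saving (hdeg : ∀ v, G.degree v ≤ 4) {r w₁ w₂ w₃ w₄ : V}
    (hN : IsNeighborhood G r w₁ w₂ w₃ w₄)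
    (htri : ∀ a b, G.Adj r a → G.Adj r b → ¬ G.Adj a b) {M R : Finset (Sym2 V)}
    {c₀ : Sym2 V → Fin 22} (hM : ∀ x, ∀ e ∈ M, ∀ f ∈ M, x ∈ e → x ∈ f → e = f)
    (hMr : ∀ e ∈ M, ∃ w z, G.Adj r w ∧ G.Adj w z ∧ z ≠ r ∧ e = s(w, z))
    (hc₀ : ProperOn G M c₀) (hRM : R ⊆ M) (hR : ∀ e ∈ R, ∃ f ∈ M \ R, c₀ f = c₀ e)
    (h₂ : 1 ≤ R.card + (shared G r w₂).card) (h₃ : 2 ≤ R.card + (shared G r w₃).card)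
    (h₄ : 3 ≤ R.card + (shared G r w₄).card) : ComponentColorable G r := by
  refine componentColorable_of_list hdeg r hM ?_ ?_ hc₀ [w₁, w₂, w₃, w₄] hN.2 ?_
  · intro e he
    obtain ⟨w, z, -, hwz, -, rfl⟩ := hMr e he
    exact hwz
  · intro e he hre
    obtain ⟨w, z, hrw, -, hzr, rfl⟩ := hMr e he
    rcases Sym2.mem_iff.1 hre with h | h
    exacts [hrw.ne h, hzr h.symm]
  intro c hc
  have key : ∀ x, G.Adj r x →
      (((around G r x).filter (r ∉ ·)).image c).card + R.card + (shared G r x).card ≤ 21 := by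
    intro x hx
    have hMx : M ⊆ around G r x := by
      intro e he
      obtain ⟨w, z, hrw, hwz, hzr, rfl⟩ := hMr e he
      simp only [around, mem_union, mem_biUnion, mem_erase, mem_neighborFinset]
      by_cases hwx : w = x
      · subst hwx
        exact Or.inr ⟨z, ⟨hzr, hwz⟩, mem_star_of_mem hwz (Sym2.mem_mk_right _ _)⟩
      · exact Or.inl ⟨w, ⟨hwx, hrw⟩, mem_image_of_mem _ (by simp [hzr, hwz])⟩
    have hsub : ((around G r x).filter (r ∉ ·)).image c ⊆ (around G r x \ R).image c := by
      intro y hy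
      obtain ⟨e, he, rfl⟩ := mem_image.1 hy
      by_cases heR : e ∈ R
      · obtain ⟨f, hf, hfe⟩ := hR e heR
        obtain ⟨hfM, hfR⟩ := mem_sdiff.1 hf
        rw [hc e (hRM heR), ← hfe, ← hc f hfM]
        exact mem_image_of_mem c (mem_sdiff.2 ⟨hMx hfM, hfR⟩)
      · exact mem_image_of_mem c (mem_sdiff.2 ⟨(mem_filter.1 he).1, heR⟩)
    have h1 := (card_le_card hsub).trans card_image_le
    have h2 := card_sdiff_add_card_eq_card (hRM.trans hMx)
    have h3 := card_around_add_card_shared_le hdeg hx htri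
    omega
  intro i hi
  have hx : ∀ x, x ∈ [w₁, w₂, w₃, w₄] → G.Adj r x := fun x => (hN.2 x).1
  simp only [List.length_cons, List.length_nil] at hi
  interval_cases i
  · have := key w₁ (hx _ (by simp))
    simp only [List.getElem_cons_zero]
    omega
  · have := key w₂ (hx _ (by simp))
    simp only [List.getElem_cons_zero, List.getElem_cons_succ]
    omega
  · have := key w₃ (hx _ (by simp))
    simp only [List.getElem_cons_zero, List.getElem_cons_succ]
    omega
  · have := key w₄ (hx _ (by simp))
    simp only [List.getElem_cons_zero, List.getElem_cons_succ]
    omega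

theorem componentColorable_of_free_pair (hdeg : ∀ v, G.degree v ≤ 4) {r w₁ w₂ w₃ w₄ : V}
    (hN : IsNeighborhood G r w₁ w₂ w₃ w₄)
    (htri : ∀ a b, G.Adj r a → G.Adj r b → ¬ G.Adj a b) {w x y z : V} (hw : G.Adj r w)
    (hx : G.Adj r x) (hwx : w ≠ x) (hfree : IsFreePair G r w x y z)
    (h₃ : 1 ≤ (shared G r w₃).card) (h₄ : 2 ≤ (shared G r w₄).card) :
    ComponentColorable G r := by
  have hnc := hfree.not_strongConflict hw hx hwx htri
  obtain ⟨⟨hwy, hxz, hyr, hzr⟩, -⟩ := hfree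
  have hne : s(w, y) ≠ s(x, z) := by
    intro h
    exact hnc (Or.inl ⟨w, Sym2.mem_mk_left _ _, h ▸ Sym2.mem_mk_left _ _⟩)
  refine componentColorable_of_saving hdeg hN htri (M := {s(w, y), s(x, z)}) (R := {s(w, y)})
    (c₀ := fun _ => 0) ?_ ?_ ?_ ?_ ?_ ?_ ?_ ?_
  · intro v e he f hf hve hvf
    simp only [mem_insert, mem_singleton] at he hf
    rcases he with rfl | rfl <;> rcases hf with rfl | rfl
    exacts [rfl, absurd (Or.inl ⟨v, hve, hvf⟩) hnc, absurd (Or.inl ⟨v, hvf, hve⟩) hnc, rfl]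
  · intro e he
    simp only [mem_insert, mem_singleton] at he
    rcases he with rfl | rfl
    exacts [⟨w, y, hw, hwy, hyr, rfl⟩, ⟨x, z, hx, hxz, hzr, rfl⟩]
  · intro e he f hf hef hconf
    simp only [coe_insert, coe_singleton, Set.mem_insert_iff, Set.mem_singleton_iff] at he hf
    rcases he with rfl | rfl <;> rcases hf with rfl | rfl
    exacts [absurd rfl hef, absurd hconf hnc, absurd (strongConflict_symm hconf) hnc,
      absurd rfl hef]
  · simp
  · intro e _
    exact ⟨s(x, z), by simp [hne.symm], rfl⟩
  all_goals simp only [card_singleton]; omega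

theorem componentColorable_of_two_free_pairs (hdeg : ∀ v, G.degree v ≤ 4)
    {r w₁ w₂ w₃ w₄ z₁ z₂ z₃ z₄ v₁ v₂ v₃ v₄ : V} (hN : IsNeighborhood G r w₁ w₂ w₃ w₄)
    (hN' : IsNeighborhood G r v₁ v₂ v₃ v₄)
    (htri : ∀ a b, G.Adj r a → G.Adj r b → ¬ G.Adj a b)
    (h : IsFreePair G r w₁ w₂ z₁ z₂) (h' : IsFreePair G r w₃ w₄ z₃ z₄)
    (hz : [z₁, z₂, z₃, z₄].Nodup) (hs : 1 ≤ (shared G r v₄).card) :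
    ComponentColorable G r := by
  have hmem : ∀ w, w ∈ [w₁, w₂, w₃, w₄] → G.Adj r w := fun w => (hN.2 w).1
  have hw₁ := hmem w₁ (by simp)
  have hw₂ := hmem w₂ (by simp)
  have hw₃ := hmem w₃ (by simp)
  have hw₄ := hmem w₄ (by simp)
  have hnd := hN.nodup_append htri h.1.1 h.1.2.1 h'.1.1 h'.1.2.1 hz
  have hM := matching_of_distinct hnd
  simp only [List.nodup_cons, List.mem_cons, List.not_mem_nil, or_false, not_or] at hnd
  have hnc := h.not_strongConflict hw₁ hw₂ (by tauto) htri
  have hnc' := h'.not_strongConflict hw₃ hw₄ (by tauto) htri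
  obtain ⟨⟨h₁, h₂, h₁r, h₂r⟩, -⟩ := h
  obtain ⟨⟨h₃, h₄, h₃r, h₄r⟩, -⟩ := h'
  have hne : ∀ {a b c d : V}, a ≠ c → a ≠ d → s(a, b) ≠ s(c, d) := by
    intro a b c d hac had heq
    rcases Sym2.eq_iff.1 heq with ⟨h, -⟩ | ⟨h, -⟩
    exacts [hac h, had h]
  have h12 : s(w₁, z₁) ≠ s(w₂, z₂) := hne (by tauto) (by tauto)
  have h13 : s(w₁, z₁) ≠ s(w₃, z₃) := hne (by tauto) (by tauto)
  have h14 : s(w₁, z₁) ≠ s(w₄, z₄) := hne (by tauto) (by tauto)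
  have h23 : s(w₂, z₂) ≠ s(w₃, z₃) := hne (by tauto) (by tauto)
  have h24 : s(w₂, z₂) ≠ s(w₄, z₄) := hne (by tauto) (by tauto)
  have h34 : s(w₃, z₃) ≠ s(w₄, z₄) := hne (by tauto) (by tauto)
  have hcard : ({s(w₁, z₁), s(w₃, z₃)} : Finset (Sym2 V)).card = 2 := card_pair h13
  refine componentColorable_of_saving hdeg hN' htri
    (M := {s(w₁, z₁), s(w₂, z₂), s(w₃, z₃), s(w₄, z₄)}) (R := {s(w₁, z₁), s(w₃, z₃)})
    (c₀ := fun e => if e = s(w₁, z₁) ∨ e = s(w₂, z₂) then 0 else 1) hM ?_ ?_ ?_ ?_ ?_ ?_ ?_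
  · intro e he
    simp only [mem_insert, mem_singleton] at he
    rcases he with rfl | rfl | rfl | rfl
    exacts [⟨_, _, hw₁, h₁, h₁r, rfl⟩, ⟨_, _, hw₂, h₂, h₂r, rfl⟩, ⟨_, _, hw₃, h₃, h₃r, rfl⟩,
      ⟨_, _, hw₄, h₄, h₄r, rfl⟩]
  · have hnc₁ := fun h => hnc (strongConflict_symm h)
    have hnc₂ := fun h => hnc' (strongConflict_symm h)
    intro e he f hf hef hconf
    simp only [coe_insert, coe_singleton, Set.mem_insert_iff, Set.mem_singleton_iff] at he hf
    rcases he with rfl | rfl | rfl | rfl <;> rcases hf with rfl | rfl | rfl | rfl <;>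
      first
        | exact absurd rfl hef
        | exact absurd hconf ‹_›
        | simp [h13.symm, h14.symm, h23.symm, h24.symm]
  · intro e
    simp only [mem_insert, mem_singleton]
    tauto
  · intro e he
    simp only [mem_insert, mem_singleton] at he
    rcases he with rfl | rfl
    · exact ⟨s(w₂, z₂), by simp [h12.symm, h23], by simp⟩
    · exact ⟨s(w₄, z₄), by simp [h14.symm, h34.symm],
        by simp [h13.symm, h23.symm, h14.symm, h24.symm]⟩
  all_goals rw [hcard]; omega

theorem componentColorable_of_transversal (hdeg : ∀ v, G.degree v ≤ 4)
    {r w₁ w₂ w₃ w₄ z₁ z₂ z₃ z₄ : V} (hN : IsNeighborhood G r w₁ w₂ w₃ w₄)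
    (htri : ∀ a b, G.Adj r a → G.Adj r b → ¬ G.Adj a b)
    (h12 : IsFreePair G r w₁ w₂ z₁ z₂) (h13 : IsFreePair G r w₁ w₃ z₁ z₃)
    (h14 : IsFreePair G r w₁ w₄ z₁ z₄) (h23 : IsFreePair G r w₂ w₃ z₂ z₃)
    (h24 : IsFreePair G r w₂ w₄ z₂ z₄) (h34 : IsFreePair G r w₃ w₄ z₃ z₄) :
    ComponentColorable G r := by
  have hmem : ∀ w, w ∈ [w₁, w₂, w₃, w₄] → G.Adj r w := fun w => (hN.2 w).1
  have hw₁ := hmem w₁ (by simp)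
  have hw₂ := hmem w₂ (by simp)
  have hw₃ := hmem w₃ (by simp)
  have hw₄ := hmem w₄ (by simp)
  have hz : [z₁, z₂, z₃, z₄].Nodup := by
    simp [h12.2.1, h13.2.1, h14.2.1, h23.2.1, h24.2.1, h34.2.1]
  have hnd := hN.nodup_append htri h12.1.1 h12.1.2.1 h34.1.1 h34.1.2.1 hz
  have hM := matching_of_distinct hnd
  simp only [List.nodup_cons, List.mem_cons, List.not_mem_nil, or_false, not_or] at hnd
  have n12 := h12.not_strongConflict hw₁ hw₂ (by tauto) htri
  have n13 := h13.not_strongConflict hw₁ hw₃ (by tauto) htri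
  have n14 := h14.not_strongConflict hw₁ hw₄ (by tauto) htri
  have n23 := h23.not_strongConflict hw₂ hw₃ (by tauto) htri
  have n24 := h24.not_strongConflict hw₂ hw₄ (by tauto) htri
  have n34 := h34.not_strongConflict hw₃ hw₄ (by tauto) htri
  have hne : ∀ {a b c d : V}, ¬ StrongConflict G s(a, b) s(c, d) → s(a, b) ≠ s(c, d) :=
    fun h heq => h (Or.inl ⟨_, Sym2.mem_mk_left _ _, heq ▸ Sym2.mem_mk_left _ _⟩)
  have hcard : ({s(w₁, z₁), s(w₂, z₂), s(w₃, z₃)} : Finset (Sym2 V)).card = 3 :=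
    card_eq_three.2 ⟨_, _, _, hne n12, hne n13, hne n23, rfl⟩
  refine componentColorable_of_saving hdeg hN htri
    (M := {s(w₁, z₁), s(w₂, z₂), s(w₃, z₃), s(w₄, z₄)})
    (R := {s(w₁, z₁), s(w₂, z₂), s(w₃, z₃)}) (c₀ := fun _ => 0) hM ?_ ?_ ?_ ?_ ?_ ?_ ?_
  · intro e he
    simp only [mem_insert, mem_singleton] at he
    rcases he with rfl | rfl | rfl | rfl
    exacts [⟨_, _, hw₁, h12.1.1, h12.1.2.2.1, rfl⟩, ⟨_, _, hw₂, h12.1.2.1, h12.1.2.2.2, rfl⟩,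
      ⟨_, _, hw₃, h34.1.1, h34.1.2.2.1, rfl⟩, ⟨_, _, hw₄, h34.1.2.1, h34.1.2.2.2, rfl⟩]
  · have hsymm : ∀ {e f : Sym2 V}, ¬ StrongConflict G e f → ¬ StrongConflict G f e :=
      fun h h' => h (strongConflict_symm h')
    intro e he f hf hef hconf
    simp only [coe_insert, coe_singleton, Set.mem_insert_iff, Set.mem_singleton_iff] at he hf
    rcases he with rfl | rfl | rfl | rfl <;> rcases hf with rfl | rfl | rfl | rfl <;>
      first
        | exact absurd rfl hef
        | exact absurd hconf ‹_›
        | exact absurd hconf (hsymm ‹_›)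
  · intro e
    simp only [mem_insert, mem_singleton]
    tauto
  · intro e _
    exact ⟨s(w₄, z₄), by simp [(hne n14).symm, (hne n24).symm, (hne n34).symm], rfl⟩
  all_goals rw [hcard]; omega

theorem card_neighborFinset_erase {r w : V} (h4 : G.degree w = 4) (h : G.Adj r w) :
    ((G.neighborFinset w).erase r).card = 3 := by
  rw [card_erase_of_mem (by simpa using h.symm), card_neighborFinset_eq_degree, h4]

/-- If no two edges at distinct neighbors of `r` are free of conflict and `r` is in a 4-cycle,
then all neighbors of `r` have a second common neighbor. -/
theorem exists_common_neighbor (hdeg : ∀ v, G.degree v ≤ 4) {r a b u : V}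
    (hr4 : ∀ w, G.Adj r w → G.degree w = 4)
    (htri : ∀ a b, G.Adj r a → G.Adj r b → ¬ G.Adj a b) (ha : G.Adj r a) (hb : G.Adj r b)
    (hab : a ≠ b) (hur : u ≠ r) (hau : G.Adj a u) (hbu : G.Adj b u)
    (hfree : ∀ w x y z, G.Adj r w → G.Adj r x → w ≠ x → ¬ IsFreePair G r w x y z) :
    ∃ t, t ≠ r ∧ ∀ w, G.Adj r w → G.Adj t w := by
  let T : V → Finset V := fun t => G.neighborFinset t ∩ G.neighborFinset r
  obtain ⟨t, ht, hmax⟩ := exists_max_image (univ.filter (· ≠ r)) (fun t => (T t).card)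
    ⟨u, by simpa using hur⟩
  simp only [mem_filter, mem_univ, true_and] at ht hmax
  refine ⟨t, ht, fun w hw => ?_⟩
  by_contra htw
  have h2 : 2 ≤ (T t).card := by
    refine le_trans ?_ (hmax u hur)
    rw [← card_pair hab]
    refine card_le_card ?_
    intro x hx
    rcases mem_insert.1 hx with rfl | hx
    · simp [T, ha, hau.symm]
    · rw [mem_singleton] at hx
      subst hx
      simp [T, hb, hbu.symm]
  have hsub : (G.neighborFinset w).erase r ⊆ G.neighborFinset t := by
    intro y hy
    obtain ⟨hyr, hwy⟩ : y ≠ r ∧ G.Adj w y := by simpa using hy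
    obtain ⟨x, hx, hxy⟩ : ∃ x ∈ T t, ¬ G.Adj x y := by
      by_contra! hall
      have hlt : (T t).card < (T y).card := by
        refine card_lt_card ⟨?_, fun hle => ?_⟩
        · intro x hx
          have := (hall x hx).symm
          simp only [T, mem_inter, mem_neighborFinset] at hx ⊢
          exact ⟨this, hx.2⟩
        · have : w ∈ T t := hle (by simp [T, hwy.symm, hw])
          simp only [T, mem_inter, mem_neighborFinset] at this
          exact htw this.1
      exact absurd (hmax y hyr) (by omega)
    simp only [T, mem_inter, mem_neighborFinset] at hx
    have hxw : x ≠ w := by rintro rfl; exact htw hx.1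
    by_contra hty
    rw [mem_neighborFinset] at hty
    refine hfree x w t y hx.2 hw hxw ⟨⟨hx.1.symm, hwy, ht, hyr⟩, ?_, hty, hxy, fun h => htw h.symm⟩
    rintro rfl
    exact htw hwy.symm
  have hdisj : Disjoint ((G.neighborFinset w).erase r) (T t) := by
    refine disjoint_left.2 fun y hy hy' => ?_
    simp only [T, mem_inter, mem_neighborFinset, mem_erase] at hy hy'
    exact htri _ _ hw hy'.2 hy.2
  have h5 := card_le_card (union_subset hsub (inter_subset_left : T t ⊆ G.neighborFinset t))
  rw [card_union_of_disjoint hdisj, card_neighborFinset_erase (hr4 w hw) hw,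
    card_neighborFinset_eq_degree] at h5
  have := hdeg t
  omega

/-- The neighbors of `w` other than `r` that are adjacent to no other neighbor of `r`. -/
def privateNeighbors (G : SimpleGraph V) [DecidableRel G.Adj] (r w : V) : Finset V :=
  ((G.neighborFinset w).erase r).filter fun u => ∀ x, G.Adj r x → G.Adj u x → x = w

theorem mem_privateNeighbors {r w u : V} : u ∈ privateNeighbors G r w ↔
    u ≠ r ∧ G.Adj w u ∧ ∀ x, G.Adj r x → G.Adj u x → x = w := by
  simp [privateNeighbors, and_assoc]

theorem card_privateNeighbors {r w : V} (h4 : G.degree w = 4) (h : G.Adj r w) :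
    3 ≤ (privateNeighbors G r w).card + (shared G r w).card := by
  rw [← card_neighborFinset_erase h4 h, ← card_filter_add_card_filter_not
    (s := (G.neighborFinset w).erase r) (fun u => ∀ x, G.Adj r x → G.Adj u x → x = w)]
  refine Nat.add_le_add_left ?_ _
  refine (card_le_card ?_).trans (card_image_le (s := shared G r w) (f := Prod.fst))
  intro u hu
  simp only [mem_filter, mem_erase, mem_neighborFinset, not_forall] at hu
  obtain ⟨⟨hur, hwu⟩, x, hx, hux, hxw⟩ := hu
  exact mem_image.2 ⟨(u, x), mem_shared.2 ⟨hur, hxw, hwu, hx, hux⟩, rfl⟩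

theorem not_adj_privateNeighbors_of_distinct (hdeg : ∀ v, G.degree v ≤ 4) {r x y z : V}
    (hx : G.Adj r x) (hy : G.Adj r y) (hz : G.Adj r z) (hyz : y ≠ z)
    (htri : ∀ a b, G.Adj r a → G.Adj r b → ¬ G.Adj a b)
    (hcx : 2 ≤ (privateNeighbors G r x).card) (hcy : 2 ≤ (privateNeighbors G r y).card)
    (hcz : 2 ≤ (privateNeighbors G r z).card)
    (hxy : ∀ p ∈ privateNeighbors G r x, ∀ q ∈ privateNeighbors G r y, G.Adj p q)
    (hxz : ∀ p ∈ privateNeighbors G r x, ∀ q ∈ privateNeighbors G r z, G.Adj p q) : False := by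
  obtain ⟨p, hp⟩ := card_pos.1 (by omega : 0 < (privateNeighbors G r x).card)
  have hdisj : Disjoint (privateNeighbors G r y) (privateNeighbors G r z) := by
    refine disjoint_left.2 fun q hq hq' => ?_
    rw [mem_privateNeighbors] at hq hq'
    exact hyz (hq'.2.2 y hy hq.2.1.symm)
  have hx' : x ∉ privateNeighbors G r y ∪ privateNeighbors G r z := by
    intro h
    rcases mem_union.1 h with h | h
    · exact htri _ _ hy hx (mem_privateNeighbors.1 h).2.1
    · exact htri _ _ hz hx (mem_privateNeighbors.1 h).2.1
  have hsub : insert x (privateNeighbors G r y ∪ privateNeighbors G r z) ⊆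
      G.neighborFinset p := by
    intro q hq
    rw [mem_neighborFinset]
    rcases mem_insert.1 hq with rfl | hq
    · exact (mem_privateNeighbors.1 hp).2.1.symm
    · rcases mem_union.1 hq with hq | hq
      exacts [hxy p hp q hq, hxz p hp q hq]
  have h5 := card_le_card hsub
  rw [card_insert_of_notMem hx', card_union_of_disjoint hdisj,
    card_neighborFinset_eq_degree] at h5
  have := hdeg p
  omega

theorem isFreePair_of_mem_privateNeighbors {r w x y z : V} (hw : G.Adj r w) (hx : G.Adj r x)
    (hwx : w ≠ x) (hy : y ∈ privateNeighbors G r w) (hz : z ∈ privateNeighbors G r x)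
    (hyz : ¬ G.Adj y z) : IsFreePair G r w x y z := by
  rw [mem_privateNeighbors] at hy hz
  refine ⟨⟨hy.2.1, hz.2.1, hy.1, hz.1⟩, ?_, hyz, ?_, ?_⟩
  · rintro rfl; exact hwx (hz.2.2 w hw hy.2.1.symm)
  · exact fun h => hwx (hz.2.2 w hw h.symm)
  · exact fun h => hwx (hy.2.2 x hx h.symm).symm

theorem componentColorable_of_privateNeighbors (hdeg : ∀ v, G.degree v ≤ 4)
    {r w₁ w₂ w₃ w₄ : V} (hN : IsNeighborhood G r w₁ w₂ w₃ w₄)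
    (htri : ∀ a b, G.Adj r a → G.Adj r b → ¬ G.Adj a b)
    (hcard : ∀ w, G.Adj r w → 2 ≤ (privateNeighbors G r w).card)
    (hs : 1 ≤ (shared G r w₄).card) : ComponentColorable G r := by
  have pairing : ∀ a b c d, [a, b, c, d].Perm [w₁, w₂, w₃, w₄] →
      (∃ p ∈ privateNeighbors G r a, ∃ q ∈ privateNeighbors G r b, ¬ G.Adj p q) →
      (∃ p ∈ privateNeighbors G r c, ∃ q ∈ privateNeighbors G r d, ¬ G.Adj p q) →
      ComponentColorable G r := by
    rintro a b c d hperm ⟨p, hp, q, hq, hpq⟩ ⟨p', hp', q', hq', hpq'⟩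
    have hN' := hN.perm hperm
    have ha := (hN'.2 a).1 (by simp)
    have hb := (hN'.2 b).1 (by simp)
    have hc := (hN'.2 c).1 (by simp)
    have hd := (hN'.2 d).1 (by simp)
    have hnd := hN'.1
    simp only [List.nodup_cons, List.mem_cons, List.not_mem_nil, or_false, not_or] at hnd
    obtain ⟨⟨hab, hac, had⟩, ⟨hbc, hbd⟩, hcd, -⟩ := hnd
    have hne : ∀ {x y u v : V}, G.Adj r x → x ≠ y → u ∈ privateNeighbors G r x →
        v ∈ privateNeighbors G r y → u ≠ v := by
      rintro x y u v hx hxy hu hv rfl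
      rw [mem_privateNeighbors] at hu hv
      exact hxy (hv.2.2 x hx hu.2.1.symm)
    refine componentColorable_of_two_free_pairs hdeg hN' hN htri
      (isFreePair_of_mem_privateNeighbors ha hb hab hp hq hpq)
      (isFreePair_of_mem_privateNeighbors hc hd hcd hp' hq' hpq') ?_ hs
    simp [hne ha hab hp hq, hne ha hac hp hp',
      hne ha had hp hq', hne hb hbc hq hp',
      hne hb hbd hq hq', hne hc hcd hp' hq']
  have h₁ := (hN.2 w₁).1 (by simp)
  have h₂ := (hN.2 w₂).1 (by simp)
  have h₃ := (hN.2 w₃).1 (by simp)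
  have h₄ := (hN.2 w₄).1 (by simp)
  have hnd := hN.1
  simp only [List.nodup_cons, List.mem_cons, List.not_mem_nil, or_false, not_or] at hnd
  obtain ⟨⟨-, -, n14⟩, ⟨n23, -⟩, -⟩ := hnd
  have hperm : [w₁, w₃, w₂, w₄].Perm [w₁, w₂, w₃, w₄] :=
    List.Perm.cons _ (List.Perm.swap _ _ _)
  by_cases h12 : ∃ p ∈ privateNeighbors G r w₁, ∃ q ∈ privateNeighbors G r w₂, ¬ G.Adj p q
  · by_cases h34 : ∃ p ∈ privateNeighbors G r w₃, ∃ q ∈ privateNeighbors G r w₄, ¬ G.Adj p q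
    · exact pairing _ _ _ _ (List.Perm.refl _) h12 h34
    · push Not at h34
      refine pairing _ _ _ _ hperm ?_ ?_ <;> by_contra! h
      · exact not_adj_privateNeighbors_of_distinct hdeg h₃ h₄ h₁ (Ne.symm n14) htri (hcard _ h₃)
          (hcard _ h₄) (hcard _ h₁) h34 fun p hp q hq => (h q hq p hp).symm
      · exact not_adj_privateNeighbors_of_distinct hdeg h₄ h₃ h₂ (Ne.symm n23) htri (hcard _ h₄)
          (hcard _ h₃) (hcard _ h₂) (fun p hp q hq => (h34 q hq p hp).symm)
          fun p hp q hq => (h q hq p hp).symm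
  · push Not at h12
    refine pairing _ _ _ _ hperm ?_ ?_ <;> by_contra! h
    · exact not_adj_privateNeighbors_of_distinct hdeg h₁ h₂ h₃ n23 htri (hcard _ h₁)
        (hcard _ h₂) (hcard _ h₃) h12 h
    · exact not_adj_privateNeighbors_of_distinct hdeg h₂ h₁ h₄ n14 htri (hcard _ h₂)
        (hcard _ h₁) (hcard _ h₄) (fun p hp q hq => (h12 q hq p hp).symm) h

theorem componentColorable_of_common_neighbor (hdeg : ∀ v, G.degree v ≤ 4) {r w₁ w₂ w₃ w₄ t : V}
    (hN : IsNeighborhood G r w₁ w₂ w₃ w₄)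
    (htri : ∀ a b, G.Adj r a → G.Adj r b → ¬ G.Adj a b) (htr : t ≠ r)
    (ht : ∀ w, G.Adj r w → G.Adj t w) : ComponentColorable G r := by
  have hs : ∀ w ∈ [w₁, w₂, w₃, w₄], 3 ≤ (shared G r w).card := by
    intro w hw
    have hrw := (hN.2 w).1 hw
    have h4 : 4 ≤ (G.neighborFinset r).card := by
      refine (List.toFinset_card_of_nodup hN.1).ge.trans ?_
      exact card_le_card fun x hx => by simpa using (hN.2 x).1 (List.mem_toFinset.1 hx)
    have h3 : 3 ≤ ((G.neighborFinset r).erase w).card := by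
      rw [card_erase_of_mem (by simpa using hrw)]
      omega
    refine h3.trans (card_le_card_of_injOn (fun x => (t, x)) ?_ ?_)
    · intro x hx
      simp only [coe_erase, Set.mem_sdiff, mem_coe, mem_neighborFinset,
        Set.mem_singleton_iff] at hx
      exact mem_shared.2 ⟨htr, hx.2, (ht w hrw).symm, hx.1, ht x hx.1⟩
    · intro x _ y _ h
      exact congrArg Prod.snd h
  have h₂ := hs w₂ (by simp)
  have h₃ := hs w₃ (by simp)
  have h₄ := hs w₄ (by simp)
  exact componentColorable_of_saving hdeg hN htri (M := ∅) (R := ∅) (c₀ := fun _ => 0)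
    (by simp) (by simp) (by simp [ProperOn]) (by simp) (by simp) (by omega) (by omega) (by omega)

theorem componentColorable_of_four_cycle (hdeg : ∀ v, G.degree v ≤ 4) {r a b u : V}
    (hr : G.degree r = 4) (hr4 : ∀ w, G.Adj r w → G.degree w = 4)
    (htri : ∀ a b, G.Adj r a → G.Adj r b → ¬ G.Adj a b) (ha : G.Adj r a) (hb : G.Adj r b)
    (hab : a ≠ b) (hur : u ≠ r) (hau : G.Adj a u) (hbu : G.Adj b u) :
    ComponentColorable G r := by
  obtain ⟨c, d, hN⟩ := exists_isNeighborhood hr ha hb hab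
  by_cases hfree : ∃ w x y z, G.Adj r w ∧ G.Adj r x ∧ w ≠ x ∧ IsFreePair G r w x y z
  · by_cases h2 : ∃ w, G.Adj r w ∧ 2 ≤ (shared G r w).card
    · obtain ⟨w, x, y, z, hw, hx, hwx, hpair⟩ := hfree
      obtain ⟨v, hv, hv2⟩ := h2
      obtain ⟨⟨t, v'⟩, hmem⟩ := card_pos.1 (by omega : 0 < (shared G r v).card)
      obtain ⟨htr, hvv, hvt, hv', htv⟩ := mem_shared.1 hmem
      obtain ⟨c', d', hN'⟩ := exists_isNeighborhood hr hv hv' hvv.symm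
      exact componentColorable_of_free_pair hdeg hN' htri hw hx hwx hpair
        (card_pos.2 ⟨(t, v), mem_shared.2 ⟨htr, hvv.symm, htv.symm, hv, hvt.symm⟩⟩) hv2
    · push Not at h2
      refine componentColorable_of_privateNeighbors hdeg hN htri (fun w hw => ?_)
        (card_pos.2 ⟨(u, b), mem_shared.2 ⟨hur, hab.symm, hau, hb, hbu.symm⟩⟩)
      have := card_privateNeighbors (hr4 w hw) hw
      have := h2 w hw
      omega
  · push Not at hfree
    obtain ⟨t, htr, ht⟩ := exists_common_neighbor hdeg hr4 htri ha hb hab hur hau hbu hfree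
    exact componentColorable_of_common_neighbor hdeg hN htri htr ht

theorem componentColorable_of_no_short_cycle (hdeg : ∀ v, G.degree v ≤ 4) {r : V}
    (hr : G.degree r = 4) (hr4 : ∀ w, G.Adj r w → G.degree w = 4)
    (htri : ∀ x, G.Reachable r x → ∀ a b, G.Adj x a → G.Adj x b → ¬ G.Adj a b)
    (hcyc : ∀ x, G.Reachable r x → ∀ a b u, G.Adj x a → G.Adj x b → a ≠ b → u ≠ x → G.Adj a u →
      ¬ G.Adj b u) : ComponentColorable G r := by
  obtain ⟨a, ha, b, hb, hab⟩ := one_lt_card.1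
    (by rw [card_neighborFinset_eq_degree, hr]; norm_num : 1 < (G.neighborFinset r).card)
  rw [mem_neighborFinset] at ha hb
  obtain ⟨w, x, hN⟩ := exists_isNeighborhood hr ha hb hab
  have hw := (hN.2 w).1 (by simp)
  have hx := (hN.2 x).1 (by simp)
  have hnd := hN.1
  simp only [List.nodup_cons, List.mem_cons, List.not_mem_nil, or_false, not_or] at hnd
  obtain ⟨⟨hwx, hwb, hwa⟩, ⟨hxb, hxa⟩, hba, -⟩ := hnd
  have hrr := htri r (.refl r)
  have hmatch : ∀ {v v' y z z'}, G.Adj r v → G.Adj r v' → G.Adj v y → G.Adj v' z → G.Adj v' z' →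
      z ≠ z' → ¬ (G.Adj y z ∧ G.Adj y z') := by
    rintro v v' y z z' hv hv' hvy hvz hvz' hzz ⟨h, h'⟩
    refine hcyc v' hv'.reachable z z' y hvz hvz' hzz ?_ h.symm h'.symm
    rintro rfl
    exact hrr _ _ hv hv' hvy
  have hpair : ∀ {v v' y z}, G.Adj r v → G.Adj r v' → v ≠ v' → (y ≠ r ∧ G.Adj v y) →
      (z ≠ r ∧ G.Adj v' z) → ¬ G.Adj y z → IsFreePair G r v v' y z := by
    intro v v' y z hv hv' hvv hy hz hyz
    refine ⟨⟨hy.2, hz.2, hy.1, hz.1⟩, ?_, hyz, fun h => ?_, fun h => ?_⟩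
    · rintro rfl
      exact hcyc r (.refl r) v v' y hv hv' hvv hy.1 hy.2 hz.2
    · exact hcyc r (.refl r) v v' z hv hv' hvv hz.1 h hz.2
    · exact hcyc r (.refl r) v v' y hv hv' hvv hy.1 hy.2 h
  obtain ⟨y, hy⟩ : ∃ y, y ≠ r ∧ G.Adj w y := by
    obtain ⟨y, hy⟩ := card_pos.1
      (by rw [card_neighborFinset_erase (hr4 w hw) hw]; norm_num :
        0 < ((G.neighborFinset w).erase r).card)
    exact ⟨y, by simpa using hy⟩
  have htwo : ∀ v, G.Adj r v → ∃ z z', z ≠ z' ∧ (z ≠ r ∧ G.Adj v z) ∧ (z' ≠ r ∧ G.Adj v z') ∧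
      ¬ G.Adj y z ∧ ¬ G.Adj y z' := by
    intro v hv
    have h1 : (((G.neighborFinset v).erase r).filter (G.Adj y)).card ≤ 1 := by
      refine card_le_one.2 fun z hz z' hz' => ?_
      simp only [mem_filter, mem_erase, mem_neighborFinset] at hz hz'
      by_contra hzz
      exact hmatch hw hv hy.2 hz.1.2 hz'.1.2 hzz ⟨hz.2, hz'.2⟩
    have h2 := card_filter_add_card_filter_not (s := (G.neighborFinset v).erase r) (G.Adj y)
    rw [card_neighborFinset_erase (hr4 v hv) hv] at h2
    obtain ⟨z, hz, z', hz', hzz⟩ := one_lt_card.1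
      (by omega : 1 < (((G.neighborFinset v).erase r).filter (¬ G.Adj y ·)).card)
    simp only [mem_filter, mem_erase, mem_neighborFinset] at hz hz'
    exact ⟨z, z', hzz, hz.1, hz'.1, hz.2, hz'.2⟩
  obtain ⟨p, p', hpp, hp, hp', hyp, hyp'⟩ := htwo x hx
  obtain ⟨q, q', hqq, hq, hq', hyq, hyq'⟩ := htwo b hb
  obtain ⟨t, t', htt, ht, ht', hyt, hyt'⟩ := htwo a ha
  have forall_pair : ∀ {v v' : V} {P : V → Prop}, P v → P v' → ∀ u ∈ [v, v'], P u := by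
    intro v v' P h h'
    simp [h, h']
  have hP : ∀ u ∈ [p, p'], (u ≠ r ∧ G.Adj x u) ∧ ¬ G.Adj y u := forall_pair ⟨hp, hyp⟩ ⟨hp', hyp'⟩
  have hQ : ∀ u ∈ [q, q'], (u ≠ r ∧ G.Adj b u) ∧ ¬ G.Adj y u := forall_pair ⟨hq, hyq⟩ ⟨hq', hyq'⟩
  have hT : ∀ u ∈ [t, t'], (u ≠ r ∧ G.Adj a u) ∧ ¬ G.Adj y u := forall_pair ⟨ht, hyt⟩ ⟨ht', hyt'⟩
  obtain ⟨z₂, h₂, z₃, h₃, z₄, h₄, h23, h24, h34⟩ := exists_independent_transversal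
    (G := G) (p := p) (p' := p') (q := q) (q' := q') (t := t) (t' := t')
    (fun u hu => ⟨hmatch hx hb (hP u hu).1.2 hq.2 hq'.2 hqq,
      hmatch hx ha (hP u hu).1.2 ht.2 ht'.2 htt⟩)
    (fun u hu => ⟨hmatch hb hx (hQ u hu).1.2 hp.2 hp'.2 hpp,
      hmatch hb ha (hQ u hu).1.2 ht.2 ht'.2 htt⟩)
    (fun u hu => ⟨hmatch ha hx (hT u hu).1.2 hp.2 hp'.2 hpp,
      hmatch ha hb (hT u hu).1.2 hq.2 hq'.2 hqq⟩)
    (fun u hu => htri u (hx.reachable.trans (hP u hu).1.2.reachable))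
  exact componentColorable_of_transversal hdeg hN hrr
    (hpair hw hx hwx hy (hP _ h₂).1 (hP _ h₂).2) (hpair hw hb hwb hy (hQ _ h₃).1 (hQ _ h₃).2)
    (hpair hw ha hwa hy (hT _ h₄).1 (hT _ h₄).2) (hpair hx hb hxb (hP _ h₂).1 (hQ _ h₃).1 h23)
    (hpair hx ha hxa (hP _ h₂).1 (hT _ h₄).1 h24) (hpair hb ha hba (hQ _ h₃).1 (hT _ h₄).1 h34)

end StrongEdgeColoring

/-- Every simple graph with maximum degree at most 4 has a strong edge-coloring
with at most 22 colors. -/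
theorem strong_edge_coloring_22 {V : Type*} [Fintype V] (G : SimpleGraph V)
    [DecidableRel G.Adj] (hdeg : ∀ v, G.degree v ≤ 4) :
    ∃ C : G.edgeSet → Fin 22, IsStrongEdgeColoring G C := by
  classical
  refine StrongEdgeColoring.exists_coloring_of_components fun v => ?_
  suffices h : ∃ r, G.Reachable v r ∧ StrongEdgeColoring.ComponentColorable G r by
    obtain ⟨r, hr, hcol⟩ := h
    exact hcol.of_reachable hr
  by_cases hlow : ∃ r, G.Reachable v r ∧ G.degree r ≤ 3
  · obtain ⟨r, hvr, hr⟩ := hlow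
    exact ⟨r, hvr, StrongEdgeColoring.componentColorable_of_degree_le_three hdeg hr⟩
  have h4 : ∀ r, G.Reachable v r → G.degree r = 4 := fun r hr => by
    by_contra hne
    exact hlow ⟨r, hr, by have := hdeg r; omega⟩
  have h4' : ∀ r, G.Reachable v r → ∀ w, G.Adj r w → G.degree w = 4 := fun r hr w hw =>
    h4 w (hr.trans hw.reachable)
  by_cases htri : ∃ r, G.Reachable v r ∧ ∃ a b, G.Adj r a ∧ G.Adj r b ∧ G.Adj a b
  · obtain ⟨r, hvr, a, b, ha, hb, hab⟩ := htri
    exact ⟨r, hvr, StrongEdgeColoring.componentColorable_of_triangle hdeg (h4 r hvr) ha hb hab⟩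
  push Not at htri
  by_cases hcyc : ∃ r, G.Reachable v r ∧ ∃ a b u, G.Adj r a ∧ G.Adj r b ∧ a ≠ b ∧ u ≠ r ∧
      G.Adj a u ∧ G.Adj b u
  · obtain ⟨r, hvr, a, b, u, ha, hb, hab, hur, hau, hbu⟩ := hcyc
    exact ⟨r, hvr, StrongEdgeColoring.componentColorable_of_four_cycle hdeg (h4 r hvr)
      (h4' r hvr) (htri r hvr) ha hb hab hur hau hbu⟩
  push Not at hcyc
  exact ⟨v, .refl v, StrongEdgeColoring.componentColorable_of_no_short_cycle hdeg
    (h4 v (.refl v)) (h4' v (.refl v)) htri hcyc⟩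
end

section
/- Every 4-regular simple graph containing no cycle of length less than 6 admits a strong edge-coloring using at most 22 colors. -/
/-- If a vertex set `P` is independent, and every vertex outside `P` always has a color avoiding
its neighbors in `P` and its neighbors of rank at least its own, then coloring by decreasing rank
extends the constant coloring of `P` to a proper coloring. -/
theorem exists_coloring_of_rank {E α : Type*} [Fintype E] (H : SimpleGraph E)
    (ρ : E → ℕ) (P : Set E) (z : α) (hP : ∀ a ∈ P, ∀ b ∈ P, ¬ H.Adj a b)
    (hfree : ∀ a ∉ P, ∀ C : E → α, (∀ p ∈ P, C p = z) →
      ∃ c, ∀ b, H.Adj a b → (b ∈ P ∨ ρ a ≤ ρ b) → C b ≠ c) :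
    ∃ C : E → α, ∀ a b, H.Adj a b → C a ≠ C b := by
  classical
  have key : ∀ s : Finset E, ∃ C : E → α, (∀ p ∈ P, C p = z) ∧
      ∀ a b, (a ∈ s ∨ a ∈ P) → (b ∈ s ∨ b ∈ P) → H.Adj a b → C a ≠ C b := by
    intro s
    induction s using Finset.induction_on_min_value ρ with
    | empty =>
      refine ⟨fun _ => z, fun _ _ => rfl, fun a b ha hb hab => ?_⟩
      simp only [Finset.notMem_empty, false_or] at ha hb
      exact absurd hab (hP a ha b hb)
    | insert a s _ hmin ih =>
      obtain ⟨C, hC0, hC⟩ := ih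
      by_cases haP : a ∈ P
      · refine ⟨C, hC0, fun b c hb hc => hC b c ?_ ?_⟩ <;> grind
      obtain ⟨c, hc⟩ := hfree a haP C hC0
      refine ⟨Function.update C a c, fun p hp => ?_, fun x y hx hy hxy => ?_⟩
      · rw [Function.update_of_ne (ne_of_mem_of_not_mem hp haP), hC0 p hp]
      · have hne := hxy.ne
        by_cases hxa : x = a
        · subst hxa
          rw [Function.update_self, Function.update_of_ne hne.symm]
          exact (hc y hxy (by grind)).symm
        by_cases hya : y = a
        · subst hya
          rw [Function.update_self, Function.update_of_ne hne]
          exact hc x hxy.symm (by grind)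
        rw [Function.update_of_ne hxa, Function.update_of_ne hya]
        exact hC x y (by grind) (by grind) hxy
  obtain ⟨C, -, hC⟩ := key Finset.univ
  exact ⟨C, fun a b => hC a b (by simp) (by simp)⟩

namespace SimpleGraph

variable {V : Type*} (G : SimpleGraph V)

/-- The graph on `Sym2 V` whose adjacent pairs are the distinct conflicting edges of `G`. -/
def strongConflictGraph : SimpleGraph (Sym2 V) where
  Adj e f := e ∈ G.edgeSet ∧ f ∈ G.edgeSet ∧ e ≠ f ∧ StrongConflict G e f
  symm := ⟨by
    rintro e f ⟨he, hf, hne, h⟩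
    refine ⟨hf, he, hne.symm, ?_⟩
    rcases h with ⟨v, h1, h2⟩ | ⟨u, v, h1, h2, h3⟩
    · exact Or.inl ⟨v, h2, h1⟩
    · exact Or.inr ⟨v, u, h2, h1, h3.symm⟩⟩
  loopless := ⟨fun _ h => h.2.2.1 rfl⟩

section Counting

variable [Fintype V] [DecidableEq V] [DecidableRel G.Adj]

/-- The edges with an endpoint adjacent to `u` or `v`, along an edge other than `s(u, v)`. -/
def edgesNear (u v : V) : Finset (Sym2 V) :=
  ((G.neighborFinset u).erase v ∪ (G.neighborFinset v).erase u).biUnion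
    fun w => G.incidenceFinset w

variable {G}

theorem card_edgesNear_le (hreg : ∀ v, G.degree v = 4) {u v : V} (h : G.Adj u v) :
    (G.edgesNear u v).card ≤ 24 := by
  have hcard : ∀ {a b : V}, G.Adj a b → ((G.neighborFinset a).erase b).card = 3 := by
    intro a b hab
    rw [Finset.card_erase_of_mem (by simpa using hab), card_neighborFinset_eq_degree, hreg]
  calc (G.edgesNear u v).card
      ≤ ((G.neighborFinset u).erase v ∪ (G.neighborFinset v).erase u).card * 4 :=
        Finset.card_biUnion_le_card_mul _ _ _ fun w _ => by
          rw [card_incidenceFinset_eq_degree, hreg]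
    _ ≤ (3 + 3) * 4 := by
        gcongr
        exact (Finset.card_union_le _ _).trans (by rw [hcard h, hcard h.symm])
    _ = 24 := rfl

theorem mem_edgesNear_of_adj {u v : V} {f : Sym2 V}
    (h : G.strongConflictGraph.Adj s(u, v) f) : f ∈ G.edgesNear u v := by
  obtain ⟨he, hf, hne, h⟩ := h
  rw [mem_edgeSet] at he
  simp only [edgesNear, Finset.mem_biUnion, Finset.mem_union, Finset.mem_erase,
    mem_neighborFinset, mem_incidenceFinset, incidenceSet, Set.mem_ofPred_eq]
  have hu : u ∈ f → ∃ w, (w ≠ v ∧ G.Adj u w) ∧ f ∈ G.edgeSet ∧ w ∈ f := by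
    intro hu
    obtain ⟨w, rfl⟩ := hu
    exact ⟨w, ⟨by rintro rfl; exact hne rfl, hf⟩, hf, by simp⟩
  have hv : v ∈ f → ∃ w, (w ≠ u ∧ G.Adj v w) ∧ f ∈ G.edgeSet ∧ w ∈ f := by
    intro hv
    obtain ⟨w, rfl⟩ := hv
    exact ⟨w, ⟨by rintro rfl; exact hne Sym2.eq_swap, hf⟩, hf, by simp⟩
  simp only [StrongConflict, Sym2.mem_iff] at h
  grind

end Counting

theorem exists_color_not_mem {E : Type*} [DecidableEq E] (C : E → Fin 22) (B : Finset E)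
    (Z : Finset (Fin 22)) (h : B.card + Z.card < 22) :
    ∃ c, c ∉ Z ∧ ∀ b ∈ B, C b ≠ c := by
  obtain ⟨c, -, hc⟩ := Finset.exists_mem_notMem_of_card_lt_card
    (s := B.image C ∪ Z) (t := Finset.univ) (by
      have := Finset.card_union_le (B.image C) Z
      have := Finset.card_image_le (s := B) (f := C)
      rw [Finset.card_univ, Fintype.card_fin]
      omega)
  simp only [Finset.mem_union, Finset.mem_image, not_or, not_exists, not_and] at hc
  exact ⟨c, hc.2, hc.1⟩

section Root

variable {G}

variable (G) in
/-- A chosen vertex of the component of `v`. -/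
noncomputable def root (v : V) : V := (G.connectedComponentMk v).out

theorem reachable_root (v : V) : G.Reachable (G.root v) v :=
  ConnectedComponent.exact (Quot.out_eq _)

theorem root_eq_of_adj {u v : V} (h : G.Adj u v) : G.root u = G.root v := by
  rw [root, root, ConnectedComponent.sound h.reachable]

variable (G) in
/-- The distance from `v` to the root of its component. -/
noncomputable def depth (v : V) : ℕ := G.dist (G.root v) v

theorem root_eq_of_depth_eq_zero {v : V} (h : G.depth v = 0) : G.root v = v :=
  (reachable_root v).dist_eq_zero_iff.mp h

theorem exists_adj_depth_lt {v : V} (h : G.depth v ≠ 0) :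
    ∃ u, G.Adj v u ∧ G.depth u < G.depth v := by
  obtain ⟨p, hp⟩ := (reachable_root (G := G) v).symm.exists_walk_length_eq_dist
  rw [dist_comm] at hp
  change p.length = G.depth v at hp
  generalize hr : G.root v = r at p
  cases p with
  | nil => simp at hp; omega
  | @cons _ u _ hvu q =>
    refine ⟨u, hvu, ?_⟩
    have hq := dist_le q
    rw [Walk.length_cons] at hp
    rw [depth, ← root_eq_of_adj hvu, hr, dist_comm]
    omega

variable (G) in
/-- The smaller depth of the two endpoints. -/
noncomputable def edgeDepth (e : Sym2 V) : ℕ := (e.map G.depth).inf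

theorem edgeDepth_le {e : Sym2 V} {v : V} (h : v ∈ e) : G.edgeDepth e ≤ G.depth v := by
  obtain ⟨w, rfl⟩ := h
  simp [edgeDepth]

end Root

section Girth

variable {G} (hgirth : ∀ (v : V) (c : G.Walk v v), c.IsCycle → 6 ≤ c.length)
include hgirth

theorem not_adj_of_adj_adj {a b c : V} (hab : G.Adj a b) (hbc : G.Adj b c) : ¬ G.Adj c a := by
  intro hca
  have := hgirth a (.cons hab (.cons hbc (.cons hca .nil))) (by
    have := hab.ne; have := hbc.ne; have := hca.ne
    simp [Walk.isCycle_def, Walk.isTrail_def]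
    grind)
  simp at this

theorem eq_of_common_adj {a b c d : V} (hab : G.Adj a b) (hbc : G.Adj b c) (had : G.Adj a d)
    (hdc : G.Adj d c) (hac : a ≠ c) : b = d := by
  by_contra hbd
  have := hgirth a (.cons hab (.cons hbc (.cons hdc.symm (.cons had.symm .nil)))) (by
    have := hab.ne; have := hbc.ne; have := had.ne; have := hdc.ne
    simp [Walk.isCycle_def, Walk.isTrail_def]
    grind)
  simp at this

theorem not_adj_of_walk_length_four {a b c d e : V} (hab : G.Adj a b) (hbc : G.Adj b c)
    (hcd : G.Adj c d) (hde : G.Adj d e) (hac : a ≠ c) (hbd : b ≠ d) (hce : c ≠ e) :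
    ¬ G.Adj e a := by
  intro hea
  have had : a ≠ d := by
    rintro rfl
    exact not_adj_of_adj_adj hgirth hab hbc hcd
  have hbe : b ≠ e := by
    rintro rfl
    exact not_adj_of_adj_adj hgirth hbc hcd hde
  have := hgirth a (.cons hab (.cons hbc (.cons hcd (.cons hde (.cons hea .nil))))) (by
    have := hab.ne; have := hbc.ne; have := hcd.ne; have := hde.ne; have := hea.ne
    simp [Walk.isCycle_def, Walk.isTrail_def]
    grind)
  simp at this

end Girth

section Twigs

variable {G}

variable (G) in
/-- The edges joining a neighbor `w` of a root to the vertex `x w`. -/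
def twigs (x : V → V) : Set (Sym2 V) := {e | ∃ w, G.Adj w (G.root w) ∧ e = s(w, x w)}

variable {x : V → V} (hx : ∀ w, G.Adj w (x w)) (hxr : ∀ w, x w ≠ G.root w)
include hx

theorem root_eq_of_strongConflict {w w' : V}
    (h : StrongConflict G s(w, x w) s(w', x w')) : G.root w = G.root w' := by
  have h1 := root_eq_of_adj (hx w)
  have h2 := root_eq_of_adj (hx w')
  rcases h with ⟨v, hv, hv'⟩ | ⟨u, v, hu, hv, huv⟩
  · rw [Sym2.mem_iff] at hv hv'
    grind
  · have h3 := root_eq_of_adj huv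
    rw [Sym2.mem_iff] at hu hv
    grind

theorem exists_twigs_at_root [Fintype V] [DecidableEq V] [DecidableRel G.Adj]
    (hreg : ∀ v, G.degree v = 4)
    (hgirth : ∀ (v : V) (c : G.Walk v v), c.IsCycle → 6 ≤ c.length) {u v : V}
    (hu : G.root u = u) (huv : G.Adj u v) (hnot : s(u, v) ∉ G.twigs x) :
    ∃ L ⊆ G.edgesNear u v, L.card = 4 ∧ ∀ e ∈ L, e ∈ G.twigs x := by
  have hroot : ∀ w, G.Adj u w → G.root w = u := fun w h => by rw [← root_eq_of_adj h, hu]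
  have hmem : ∀ w, G.Adj u w → s(w, x w) ∈ G.twigs x := fun w h =>
    ⟨w, by rw [hroot w h]; exact h.symm, rfl⟩
  refine ⟨(G.neighborFinset u).image fun w => s(w, x w), ?_, ?_, ?_⟩
  · intro e he
    simp only [Finset.mem_image, mem_neighborFinset] at he
    obtain ⟨w, hw, rfl⟩ := he
    exact mem_edgesNear_of_adj ⟨huv, hx w, fun h => hnot (h ▸ hmem w hw),
      Or.inr ⟨u, w, by simp, by simp, hw⟩⟩
  · rw [Finset.card_image_of_injOn, card_neighborFinset_eq_degree, hreg]
    intro w hw w' hw' h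
    simp only [Finset.mem_coe, mem_neighborFinset] at hw hw'
    rcases Sym2.eq_iff.mp h with h | h
    · exact h.1
    · exact absurd hw'.symm (not_adj_of_adj_adj hgirth hw (h.2 ▸ hx w))
  · intro e he
    simp only [Finset.mem_image, mem_neighborFinset] at he
    obtain ⟨w, hw, rfl⟩ := he
    exact hmem w hw

include hxr

theorem not_strongConflict_of_mem_twigs
    (hgirth : ∀ (v : V) (c : G.Walk v v), c.IsCycle → 6 ≤ c.length) {e f : Sym2 V}
    (he : e ∈ G.twigs x) (hf : f ∈ G.twigs x) : ¬ G.strongConflictGraph.Adj e f := by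
  obtain ⟨w, hw, rfl⟩ := he
  obtain ⟨w', hw', rfl⟩ := hf
  rintro ⟨-, -, hne, h⟩
  have hr := root_eq_of_strongConflict hx h
  have hww : w ≠ w' := by
    rintro rfl
    exact hne rfl
  have hxw := hxr w
  have hxw' := hxr w'
  rw [← hr] at hw' hxw'
  have nadj : ¬ G.Adj w w' := fun h => not_adj_of_adj_adj hgirth hw.symm h hw'
  have nadj_x : ¬ G.Adj w (x w') := fun h =>
    hww (eq_of_common_adj hgirth hw.symm h hw'.symm (hx w') hxw'.symm)
  have nadj_x' : ¬ G.Adj (x w) w' := fun h =>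
    hxw (eq_of_common_adj hgirth (hx w) h hw hw'.symm hww)
  have hxx : x w ≠ x w' := fun h => nadj_x (h ▸ hx w)
  have nadj_xx : ¬ G.Adj (x w) (x w') := fun h =>
    not_adj_of_walk_length_four hgirth hw.symm (hx w) h (hx w').symm hxw.symm
      (fun h => nadj (h ▸ (hx w').symm)) (fun h => nadj (h ▸ hx w)) hw'
  simp only [StrongConflict, Sym2.mem_iff] at h
  have := hx w
  have := (hx w').symm
  rcases h with ⟨v, rfl | rfl, h | h⟩ | ⟨u, v, rfl | rfl, rfl | rfl, h⟩ <;> grind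

theorem card_incidenceFinset_filter_twigs_le [Fintype V] [DecidableEq V] [DecidableRel G.Adj]
    [DecidablePred (· ∈ G.twigs x)]
    (hgirth : ∀ (v : V) (c : G.Walk v v), c.IsCycle → 6 ≤ c.length) (u : V) :
    ((G.incidenceFinset u).filter (· ∈ G.twigs x)).card ≤ 1 := by
  refine Finset.card_le_one.mpr fun e he f hf => ?_
  simp only [Finset.mem_filter, mem_incidenceFinset] at he hf
  by_contra hne
  exact not_strongConflict_of_mem_twigs hx hxr hgirth he.2 hf.2
    ⟨he.1.1, hf.1.1, hne, Or.inl ⟨u, he.1.2, hf.1.2⟩⟩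

theorem exists_edgesNear_shallower [Fintype V] [DecidableEq V] [DecidableRel G.Adj]
    (hreg : ∀ v, G.degree v = 4)
    (hgirth : ∀ (v : V) (c : G.Walk v v), c.IsCycle → 6 ≤ c.length) {u v : V}
    (hu : G.depth u ≠ 0) (huv : G.Adj u v) (hle : G.depth u ≤ G.depth v) :
    ∃ L ⊆ G.edgesNear u v, 3 ≤ L.card ∧
      ∀ e ∈ L, e ∉ G.twigs x ∧ G.edgeDepth e < G.edgeDepth s(u, v) := by
  classical
  obtain ⟨t, hut, ht⟩ := exists_adj_depth_lt hu
  have hlt : ∀ e, t ∈ e → G.edgeDepth e < G.edgeDepth s(u, v) := fun e he =>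
    (edgeDepth_le he).trans_lt (by simpa [edgeDepth] using ⟨ht, ht.trans_le hle⟩)
  refine ⟨(G.incidenceFinset t).filter (· ∉ G.twigs x), ?_, ?_, ?_⟩
  · intro e he
    simp only [Finset.mem_filter, mem_incidenceFinset] at he
    refine mem_edgesNear_of_adj ⟨huv, he.1.1, ?_, Or.inr ⟨u, t, by simp, he.1.2, hut⟩⟩
    rintro rfl
    exact (hlt _ he.1.2).false
  · have h1 := Finset.card_filter_add_card_filter_not (s := G.incidenceFinset t) (· ∈ G.twigs x)
    rw [card_incidenceFinset_eq_degree, hreg] at h1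
    have := card_incidenceFinset_filter_twigs_le hx hxr hgirth t
    omega
  · intro e he
    simp only [Finset.mem_filter, mem_incidenceFinset] at he
    exact ⟨he.2, hlt e he.1.2⟩

theorem exists_free_color [Fintype V] [DecidableEq V] [DecidableRel G.Adj]
    (hreg : ∀ v, G.degree v = 4)
    (hgirth : ∀ (v : V) (c : G.Walk v v), c.IsCycle → 6 ≤ c.length) {e : Sym2 V}
    (he : e ∉ G.twigs x) (C : Sym2 V → Fin 22) (hC : ∀ f ∈ G.twigs x, C f = 0) :
    ∃ c, ∀ f, G.strongConflictGraph.Adj e f →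
      (f ∈ G.twigs x ∨ G.edgeDepth e ≤ G.edgeDepth f) → C f ≠ c := by
  by_cases hedge : e ∈ G.edgeSet
  swap
  · exact ⟨0, fun f hf => absurd hf.1 hedge⟩
  obtain ⟨u, v, rfl, hle⟩ : ∃ u v, e = s(u, v) ∧ G.depth u ≤ G.depth v := by
    induction e with | h u v =>
    rcases le_total (G.depth u) (G.depth v) with h | h
    · exact ⟨u, v, rfl, h⟩
    · exact ⟨v, u, Sym2.eq_swap, h⟩
  rw [mem_edgeSet] at hedge
  have hcard := card_edgesNear_le hreg hedge
  by_cases hu : G.depth u = 0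
  · obtain ⟨L, hL, hL4, hLt⟩ :=
      exists_twigs_at_root hx hreg hgirth (root_eq_of_depth_eq_zero hu) hedge he
    obtain ⟨c, hcZ, hc⟩ := exists_color_not_mem C (G.edgesNear u v \ L) {0} (by
      rw [Finset.card_sdiff_of_subset hL, Finset.card_singleton]
      omega)
    refine ⟨c, fun f hf _ => ?_⟩
    by_cases hfL : f ∈ L
    · rw [hC f (hLt f hfL)]
      exact fun h => hcZ (by simp [h])
    · exact hc f (Finset.mem_sdiff.mpr ⟨mem_edgesNear_of_adj hf, hfL⟩)
  · obtain ⟨L, hL, hL3, hLt⟩ := exists_edgesNear_shallower hx hxr hreg hgirth hu hedge hle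
    obtain ⟨c, -, hc⟩ := exists_color_not_mem C (G.edgesNear u v \ L) ∅ (by
      rw [Finset.card_sdiff_of_subset hL, Finset.card_empty]
      omega)
    refine ⟨c, fun f hf hfr => hc f (Finset.mem_sdiff.mpr ⟨mem_edgesNear_of_adj hf, fun hfL => ?_⟩)⟩
    obtain ⟨h1, h2⟩ := hLt f hfL
    exact hfr.elim h1 h2.not_ge

end Twigs

end SimpleGraph

/-- Every 4-regular simple graph with no cycle of length less than 6 has a
strong edge-coloring with at most 22 colors. -/
theorem strong_edge_coloring_4regular_girth_ge_6 {V : Type*} [Fintype V]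
    (G : SimpleGraph V) [DecidableRel G.Adj]
    (hreg : ∀ v, G.degree v = 4)
    (hgirth : ∀ (v : V) (c : G.Walk v v), c.IsCycle → 6 ≤ c.length) :
    ∃ C : G.edgeSet → Fin 22, IsStrongEdgeColoring G C := by
  classical
  have hex : ∀ w, ∃ y, G.Adj w y ∧ y ≠ G.root w := by
    intro w
    obtain ⟨y, hy, hne⟩ := Finset.exists_mem_ne
      (by rw [G.card_neighborFinset_eq_degree, hreg]; norm_num :
        1 < (G.neighborFinset w).card) (G.root w)
    exact ⟨y, by simpa using hy, hne⟩
  choose x hx hxr using hex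
  obtain ⟨C, hC⟩ := exists_coloring_of_rank G.strongConflictGraph G.edgeDepth (G.twigs x)
    (0 : Fin 22)
    (fun _ ha _ hb => SimpleGraph.not_strongConflict_of_mem_twigs hx hxr hgirth ha hb)
    (fun _ ha C hC => SimpleGraph.exists_free_color hx hxr hreg hgirth ha C hC)
  exact ⟨fun e => C e, fun e f hne h =>
    hC e f ⟨e.2, f.2, fun h => hne (Subtype.ext h), h⟩⟩
end
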